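/- Let (u, p) be a weak solution of the HHMO model in the transitional regime u*₀ < u* < Ψ(α). Then there exists X > 0 such that p(x,t) = 0 for all t ≥ 0 and all x with |x| ≥ X, and u converges uniformly to the profile Φ₀, i.e. lim_{t→∞} sup_{η≥0} |u(η√t, t) − Φ₀(η)| = 0. -/

import Mathlib

open MeasureTheory Filter Set

noncomputable section

/-- The precipitation-free self-similar solution `ψ(x,t)`. -/
def psi (α β x t : ℝ) : ℝ :=
  if 0 < t then
    (α * β / 2) * Real.exp (α ^ 2 / 4) *
      ∫ ζ in Set.Ioi (max (|x| / Real.sqrt t) α), Real.exp (-ζ ^ 2 / 4)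
  else 0

/-- The profile `Ψ(η)` in similarity coordinates. -/
def PsiP (α β η : ℝ) : ℝ :=
  (α * β / 2) * Real.exp (α ^ 2 / 4) * ∫ ζ in Set.Ioi (max η α), Real.exp (-ζ ^ 2 / 4)

/-- Regularity of a weak solution: `w` is the spatial derivative of `u - ψ`;
both are continuous on `ℝ × [0,∞)` and bounded on `ℝ × [0,T]` for every `T > 0`. -/
def AuxReg (α β : ℝ) (u w : ℝ → ℝ → ℝ) : Prop :=
  (∀ t ∈ Set.Ici (0:ℝ), ∀ x : ℝ, HasDerivAt (fun y => u y t - psi α β y t) (w x t) x) ∧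
  ContinuousOn (fun q : ℝ × ℝ => u q.1 q.2 - psi α β q.1 q.2) (Set.univ ×ˢ Set.Ici 0) ∧
  ContinuousOn (fun q : ℝ × ℝ => w q.1 q.2) (Set.univ ×ˢ Set.Ici 0) ∧
  ∀ T > (0:ℝ), ∃ C : ℝ, ∀ x : ℝ, ∀ t ∈ Set.Icc (0:ℝ) T,
    |u x t - psi α β x t| ≤ C ∧ |w x t| ≤ C

/-- A test function of class `C^{1,1}(ℝ × [0,T])`, vanishing for large `|x|` and at `t = T`,
together with its partial derivatives `φt`, `φx`. -/
def IsTestFun (T : ℝ) (φ φt φx : ℝ → ℝ → ℝ) : Prop :=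
  (∀ x : ℝ, ∀ t ∈ Set.Icc (0:ℝ) T,
    HasDerivWithinAt (fun s => φ x s) (φt x t) (Set.Icc 0 T) t) ∧
  (∀ x : ℝ, ∀ t ∈ Set.Icc (0:ℝ) T, HasDerivAt (fun y => φ y t) (φx x t) x) ∧
  ContinuousOn (fun q : ℝ × ℝ => φ q.1 q.2) (Set.univ ×ˢ Set.Icc 0 T) ∧
  ContinuousOn (fun q : ℝ × ℝ => φt q.1 q.2) (Set.univ ×ˢ Set.Icc 0 T) ∧
  ContinuousOn (fun q : ℝ × ℝ => φx q.1 q.2) (Set.univ ×ˢ Set.Icc 0 T) ∧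
  (∃ R : ℝ, ∀ x : ℝ, ∀ t ∈ Set.Icc (0:ℝ) T, R ≤ |x| → φ x t = 0) ∧
  (∀ x : ℝ, φ x T = 0)

/-- The weak form of the equation, relative to a given precipitation function `p` and
the spatial derivative `w` of `u - ψ`. -/
def WeakForm (α β : ℝ) (u p w : ℝ → ℝ → ℝ) : Prop :=
  ∀ T > (0:ℝ), ∀ φ φt φx : ℝ → ℝ → ℝ, IsTestFun T φ φt φx →
    (∫ t in Set.Ioc (0:ℝ) T, ∫ x : ℝ, φt x t * (u x t - psi α β x t))
      = ∫ t in Set.Ioc (0:ℝ) T, ∫ x : ℝ, (φx x t * w x t + p x t * u x t * φ x t)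

/-- A weak solution of the linear auxiliary problem with given precipitation function `p`. -/
def IsAuxSolution (α β : ℝ) (p u : ℝ → ℝ → ℝ) : Prop :=
  (∀ x t : ℝ, u (-x) t = u x t) ∧
  ∃ w : ℝ → ℝ → ℝ, AuxReg α β u w ∧ WeakForm α β u p w

/-- A weak solution `(u, p)` of the HHMO model. -/
def IsWeakSolution (α β ustar : ℝ) (u p : ℝ → ℝ → ℝ) : Prop :=
  (∀ x t : ℝ, u (-x) t = u x t) ∧
  (∀ x t : ℝ, p (-x) t = p x t) ∧
  Measurable (fun q : ℝ × ℝ => p q.1 q.2) ∧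
  (∀ x : ℝ, ∀ t ∈ Set.Ici (0:ℝ),
    (sSup ((fun s => u x s) '' Set.Icc 0 t) < ustar → p x t = 0) ∧
    (sSup ((fun s => u x s) '' Set.Icc 0 t) = ustar → p x t ∈ Set.Icc (0:ℝ) 1) ∧
    (ustar < sSup ((fun s => u x s) '' Set.Icc 0 t) → p x t = 1)) ∧
  (∀ x : ℝ, MonotoneOn (fun t => p x t) (Set.Ici (0:ℝ))) ∧
  ∃ w : ℝ → ℝ → ℝ, AuxReg α β u w ∧ WeakForm α β u p w

/-- Condition (P): the precipitation function depends only on `x` beyond the parabola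
`t = x²/α²`. -/
def CondP (α : ℝ) (p : ℝ → ℝ → ℝ) (pstar : ℝ → ℝ) : Prop :=
  Measurable pstar ∧
  ∀ᵐ x ∂(volume.restrict (Set.Ioi (0:ℝ))), ∀ t : ℝ, x ^ 2 / α ^ 2 < t → p x t = pstar x

/-- The admissible class `𝒜` of precipitation functions. -/
def IsAdmissible (p : ℝ → ℝ → ℝ) : Prop :=
  (∀ x t : ℝ, p (-x) t = p x t) ∧
  MeasureTheory.LocallyIntegrableOn (fun q : ℝ × ℝ => p q.1 q.2) (Set.Ioi 0 ×ˢ Set.Ici 0) ∧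
  ∀ T > (0:ℝ), ∃ R : ℝ, ∀ x ≥ R, ∀ t ∈ Set.Icc (0:ℝ) T, p x t = 0

/-- `u` converges uniformly, in parabolic similarity coordinates, to the profile `Φ`. -/
def ConvUnif (u : ℝ → ℝ → ℝ) (Φ : ℝ → ℝ) : Prop :=
  ∀ ε > (0:ℝ), ∃ T : ℝ, ∀ t ≥ T, ∀ η ≥ (0:ℝ), |u (η * Real.sqrt t) t - Φ η| < ε

/-- The error function. -/
def erf (x : ℝ) : ℝ := (2 / Real.sqrt Real.pi) * ∫ s in (0:ℝ)..x, Real.exp (-s ^ 2)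

/-- The complementary error function. -/
def erfc (x : ℝ) : ℝ := (2 / Real.sqrt Real.pi) * ∫ s in Set.Ioi x, Real.exp (-s ^ 2)

/-- Kummer's confluent hypergeometric function `M(a,b,z)` (real arguments). -/
def kummerM (a b z : ℝ) : ℝ :=
  ∑' n : ℕ, (Polynomial.eval a (ascPochhammer ℝ n) / Polynomial.eval b (ascPochhammer ℝ n))
    * z ^ n / (n.factorial : ℝ)

/-- `κ = (1 + √(4γ+1))/2`, the positive root of `κ(κ-1) = γ`. -/
def kappaOf (γ : ℝ) : ℝ := (1 + Real.sqrt (4 * γ + 1)) / 2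

/-- The value `u*_γ` determined by the derivative matching condition. -/
def ustarGamma (α β γ : ℝ) : ℝ :=
  (α * β / 2) *
    (kappaOf γ * kummerM (kappaOf γ / 2 + 1) (kappaOf γ + 1 / 2) (-α ^ 2 / 4) /
        (α * kummerM (kappaOf γ / 2) (kappaOf γ + 1 / 2) (-α ^ 2 / 4)) +
      Real.exp (-α ^ 2 / 4) / (Real.sqrt Real.pi * erfc (α / 2)))⁻¹

/-- The self-similar profile `Φ_γ`. -/
def Phi (α β γ η : ℝ) : ℝ :=
  if η < α then
    ustarGamma α β γ * η ^ kappaOf γ *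
      kummerM (kappaOf γ / 2) (kappaOf γ + 1 / 2) (-η ^ 2 / 4) /
      (α ^ kappaOf γ * kummerM (kappaOf γ / 2) (kappaOf γ + 1 / 2) (-α ^ 2 / 4))
  else ustarGamma α β γ * erfc (η / 2) / erfc (α / 2)

/-- The critical threshold `u*₀`. -/
def ustarZero (α β : ℝ) : ℝ :=
  (α * β * Real.sqrt Real.pi / 2) * Real.exp (α ^ 2 / 4) * erf (α / 2) * erfc (α / 2)

/-- The critical profile `Φ₀`. -/
def PhiZero (α β η : ℝ) : ℝ :=
  if η < α then ustarZero α β * erf (η / 2) / erf (α / 2)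
  else ustarZero α β * erfc (η / 2) / erfc (α / 2)

section WeakToStrong

/-- Integration by parts against an antiderivative vanishing at the right endpoint. -/
lemma integral_tail_mul {a b : ℝ} {θ k : ℝ → ℝ} (hθ : Continuous θ)
    (hk : IntervalIntegrable k volume a b) :
    ∫ s in a..b, (∫ r in s..b, θ r) * k s = ∫ r in a..b, θ r * ∫ s in a..r, k s := by
  have hf : AbsolutelyContinuousOnInterval (fun s => ∫ r in b..s, θ r) a b :=
    (hθ.intervalIntegrable a b).absolutelyContinuousOnInterval_intervalIntegral right_mem_uIcc
  have hg : AbsolutelyContinuousOnInterval (fun r => ∫ s in a..r, k s) a b :=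
    hk.absolutelyContinuousOnInterval_intervalIntegral left_mem_uIcc
  have h := hf.integral_mul_deriv_eq_deriv_mul hg
  have h1 : ∫ x in a..b, (∫ r in b..x, θ r) * deriv (fun r => ∫ s in a..r, k s) x
      = ∫ s in a..b, -((∫ r in s..b, θ r) * k s) := by
    apply intervalIntegral.integral_congr_ae
    filter_upwards [hk.ae_hasDerivAt_integral] with x hx hx'
    rw [(hx (uIoc_subset_uIcc hx') a left_mem_uIcc).deriv, intervalIntegral.integral_symm]
    ring
  have h2 : ∀ x, deriv (fun s => ∫ r in b..s, θ r) x = θ x := fun x =>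
    (hθ.integral_hasStrictDerivAt b x).hasDerivAt.deriv
  simp only [h1, h2, intervalIntegral.integral_neg, intervalIntegral.integral_same] at h
  linarith

/-- A continuous function with vanishing square integral over an interval vanishes there. -/
lemma eq_zero_of_integral_weight_sq {a b : ℝ} {ρ Y : ℝ → ℝ} (hρ : Continuous ρ)
    (hY : Continuous Y) (hpos : ∀ x ∈ Icc a b, 0 ≤ ρ x) (h : ∫ x in a..b, ρ x * Y x ^ 2 = 0)
    {x : ℝ} (hx : x ∈ Icc a b) (hρx : 0 < ρ x) (hab : a < b) : Y x = 0 := by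
  by_contra hne
  have : 0 < ∫ x in a..b, ρ x * Y x ^ 2 := by
    apply intervalIntegral.integral_pos hab (by fun_prop)
    · intro y hy
      exact mul_nonneg (hpos y (Ioc_subset_Icc_self hy)) (sq_nonneg _)
    · exact ⟨x, hx, by positivity⟩
  linarith

/-- Du Bois-Reymond lemma in time, including the initial condition. -/
lemma eq_neg_integral_of_weak {T : ℝ} (hT : 0 < T) {A B : ℝ → ℝ} (hA : Continuous A)
    (hB : ∀ a b, IntervalIntegrable B volume a b)
    (h : ∀ θ : ℝ → ℝ, Continuous θ →
      ∫ t in (0:ℝ)..T, (-θ t) * A t = ∫ t in (0:ℝ)..T, (∫ r in t..T, θ r) * B t)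
    {s : ℝ} (hs : s ∈ Icc 0 T) : A s = -∫ t in (0:ℝ)..s, B t := by
  have hP : Continuous fun s => ∫ t in (0:ℝ)..s, B t := intervalIntegral.continuous_primitive hB 0
  set Y : ℝ → ℝ := fun s => A s + ∫ t in (0:ℝ)..s, B t with hYdef
  have hY : Continuous Y := hA.add hP
  have h1 := h Y hY
  rw [integral_tail_mul hY (hB 0 T)] at h1
  have h2 : ∫ t in (0:ℝ)..T, 1 * Y t ^ 2 = 0 := by
    have : ∀ t, 1 * Y t ^ 2 = Y t * (∫ s in (0:ℝ)..t, B s) - (-Y t) * A t := by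
      intro t; simp only [hYdef]; ring
    simp only [this]
    rw [intervalIntegral.integral_sub, h1, sub_self]
    · exact (hY.mul hP).intervalIntegrable _ _
    · exact (hY.neg.mul hA).intervalIntegrable _ _
  have h3 := eq_zero_of_integral_weight_sq continuous_const hY (fun _ _ => zero_le_one) h2 hs
    one_pos hT
  simp only [hYdef] at h3
  linarith

/-- Du Bois-Reymond lemma in space. -/
lemma sub_eq_integral_of_weak {W k : ℝ → ℝ} (hW : Continuous W)
    (hk : ∀ a b, IntervalIntegrable k volume a b)
    (h : ∀ R > (0:ℝ), ∀ ξ η : ℝ → ℝ, Continuous η → (∀ x, HasDerivAt ξ (η x) x) →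
      (∀ x, R ≤ |x| → ξ x = 0) → (∀ x, R ≤ |x| → η x = 0) →
      ∫ x in (-R)..R, (η x * W x + ξ x * k x) = 0) (a b : ℝ) :
    W b - W a = ∫ x in a..b, k x := by
  obtain ⟨R, hR0, haR, hbR⟩ : ∃ R > (0:ℝ), |a| < R ∧ |b| < R :=
    ⟨max |a| |b| + 1, by positivity, by linarith [le_max_left |a| |b|],
      by linarith [le_max_right |a| |b|]⟩
  have hH : Continuous fun x => ∫ y in (-R)..x, k y := intervalIntegral.continuous_primitive hk (-R)
  set H : ℝ → ℝ := fun x => ∫ y in (-R)..x, k y with hHdef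
  set ρ : ℝ → ℝ := fun x => max (R - |x|) 0 with hρdef
  have hρ : Continuous ρ := by fun_prop
  have hρ0 : ∀ x, 0 ≤ ρ x := fun x => le_max_right _ _
  have hρR : ∀ x, R ≤ |x| → ρ x = 0 := fun x hx => max_eq_right (by linarith)
  have hRR : -R < R := by linarith
  have hI : 0 < ∫ x in (-R)..R, ρ x := by
    apply intervalIntegral.integral_pos hRR hρ.continuousOn (fun x _ => hρ0 x)
    exact ⟨0, by constructor <;> linarith, by simp [hρdef, hR0]⟩
  set c : ℝ := (∫ x in (-R)..R, ρ x * (W x - H x)) / ∫ x in (-R)..R, ρ x with hc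
  set η : ℝ → ℝ := fun x => ρ x * (W x - H x - c) with hηdef
  have hη : Continuous η := by fun_prop
  have hηR : ∀ x, R ≤ |x| → η x = 0 := fun x hx => by simp [hηdef, hρR x hx]
  have hη0 : ∫ x in (-R)..R, η x = 0 := by
    have : ∀ x, η x = ρ x * (W x - H x) - c * ρ x := fun x => by simp only [hηdef]; ring
    simp only [this]
    rw [intervalIntegral.integral_sub, intervalIntegral.integral_const_mul, hc,
      div_mul_cancel₀ _ hI.ne', sub_self]
    · exact Continuous.intervalIntegrable (by fun_prop) _ _
    · exact Continuous.intervalIntegrable (by fun_prop) _ _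
  set ξ : ℝ → ℝ := fun x => ∫ y in (-R)..x, η y with hξdef
  have hξtail : ∀ x, ξ x = -∫ y in x..R, η y := by
    intro x
    have := intervalIntegral.integral_add_adjacent_intervals
      (hη.intervalIntegrable (μ := volume) (-R) x) (hη.intervalIntegrable x R)
    simp only [hξdef]
    linarith
  have hξR : ∀ x, R ≤ |x| → ξ x = 0 := by
    intro x hx
    rcases le_abs'.1 hx with hx | hx
    · simp only [hξdef]
      rw [intervalIntegral.integral_symm, intervalIntegral.integral_zero_ae, neg_zero]
      refine Eventually.of_forall fun y hy => hηR y ?_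
      rw [uIoc_of_le hx] at hy
      rw [le_abs']; left; exact hy.2
    · rw [hξtail, intervalIntegral.integral_symm, intervalIntegral.integral_zero_ae, neg_zero,
        neg_zero]
      refine Eventually.of_forall fun y hy => hηR y ?_
      rw [uIoc_of_le hx] at hy
      rw [le_abs']; right; exact hy.1.le
  have key := h R hR0 ξ η hη (fun x => (hη.integral_hasStrictDerivAt (-R) x).hasDerivAt) hξR hηR
  have hξc : Continuous ξ := intervalIntegral.continuous_primitive
    (fun a b => hη.intervalIntegrable a b) (-R)
  have hi : IntervalIntegrable (fun x => η x * W x) volume (-R) R :=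
    (hη.mul hW).intervalIntegrable _ _
  rw [intervalIntegral.integral_add hi ((hk _ _).continuousOn_mul hξc.continuousOn)] at key
  have h4 : ∫ x in (-R)..R, ξ x * k x = -∫ x in (-R)..R, η x * H x := by
    rw [← integral_tail_mul hη (hk (-R) R), ← intervalIntegral.integral_neg]
    simp only [hξtail, neg_mul]
  have h5 : ∫ x in (-R)..R, ρ x * (W x - H x - c) ^ 2 = 0 := by
    have : ∀ x, ρ x * (W x - H x - c) ^ 2 = η x * W x - η x * H x - c * η x := fun x => by
      simp only [hηdef]; ring
    simp only [this]
    rw [intervalIntegral.integral_sub, intervalIntegral.integral_sub,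
      intervalIntegral.integral_const_mul, hη0]
    · linarith
    all_goals exact Continuous.intervalIntegrable (by fun_prop) _ _
  have h6 : ∀ x, |x| < R → W x - H x - c = 0 := fun x hx =>
    eq_zero_of_integral_weight_sq hρ (Y := fun x => W x - H x - c) (by fun_prop)
      (fun x _ => hρ0 x) h5 ⟨(abs_lt.1 hx).1.le, (abs_lt.1 hx).2.le⟩
      (lt_max_of_lt_left (by linarith)) hRR
  have h7 := intervalIntegral.integral_add_adjacent_intervals (hk (-R) a) (hk a b)
  have ha := h6 a haR
  have hb := h6 b hbR
  simp only [hHdef] at ha hb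
  linarith

end WeakToStrong

section Rectangle

open Function

lemma integral_eq_of_zero_outside {g : ℝ → ℝ} {R : ℝ} (h : ∀ x, R ≤ |x| → g x = 0) :
    ∫ x, g x = ∫ x in (-R)..R, g x := by
  refine (intervalIntegral.integral_eq_integral_of_support_subset fun x hx => ?_).symm
  have : |x| < R := by
    by_contra! hc
    exact hx (h x hc)
  exact ⟨(abs_lt.1 this).1, (abs_lt.1 this).2.le⟩

lemma integrableOn_rect {F : ℝ → ℝ → ℝ} (hF : Measurable (uncurry F))
    (hFb : ∀ T, ∃ C, ∀ x t, t ≤ T → |F x t| ≤ C) (a b c d : ℝ) :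
    IntegrableOn (uncurry F) (uIoc a b ×ˢ uIoc c d) := by
  obtain ⟨C, hC⟩ := hFb (max c d)
  have hfin : (volume : Measure (ℝ × ℝ)) (uIoc a b ×ˢ uIoc c d) < ⊤ := by
    rw [Measure.volume_eq_prod, Measure.prod_prod]
    simp [uIoc, ENNReal.mul_lt_top]
  refine Measure.integrableOn_of_bounded hfin.ne hF.aestronglyMeasurable (M := C) ?_
  refine (ae_restrict_iff' (measurableSet_uIoc.prod measurableSet_uIoc)).2 ?_
  exact Eventually.of_forall fun q hq => hC q.1 q.2 hq.2.2

lemma measurable_integral_left {F : ℝ → ℝ → ℝ} (hF : Measurable (uncurry F)) (a b : ℝ) :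
    Measurable fun t => ∫ x in a..b, F x t := by
  simp only [intervalIntegral.intervalIntegral_eq_integral_uIoc]
  have h := (hF.stronglyMeasurable.integral_prod_left (μ := volume.restrict (uIoc a b))).measurable
  exact h.const_smul (if a ≤ b then (1 : ℝ) else -1)

lemma measurable_integral_right {F : ℝ → ℝ → ℝ} (hF : Measurable (uncurry F)) (a b : ℝ) :
    Measurable fun x => ∫ t in a..b, F x t := by
  simp only [intervalIntegral.intervalIntegral_eq_integral_uIoc]
  have h := (hF.stronglyMeasurable.integral_prod_right (ν := volume.restrict (uIoc a b))).measurable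
  exact h.const_smul (if a ≤ b then (1 : ℝ) else -1)

lemma intervalIntegrable_of_bound {g : ℝ → ℝ} (hg : Measurable g) {a b C : ℝ}
    (h : ∀ x ∈ uIoc a b, |g x| ≤ C) : IntervalIntegrable g volume a b := by
  rw [intervalIntegrable_iff]
  refine Measure.integrableOn_of_bounded (by simp [uIoc]) hg.aestronglyMeasurable (M := C) ?_
  exact (ae_restrict_iff' measurableSet_uIoc).2 (Eventually.of_forall h)

lemma intervalIntegrable_time {F : ℝ → ℝ → ℝ} (hF : Measurable (uncurry F))
    (hFb : ∀ T, ∃ C, ∀ x t, t ≤ T → |F x t| ≤ C) (x a b : ℝ) :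
    IntervalIntegrable (F x) volume a b := by
  obtain ⟨C, hC⟩ := hFb (max a b)
  exact intervalIntegrable_of_bound (hF.comp measurable_prodMk_left) fun t ht => hC x t ht.2

lemma intervalIntegrable_space {F : ℝ → ℝ → ℝ} (hF : Measurable (uncurry F))
    (hFb : ∀ T, ∃ C, ∀ x t, t ≤ T → |F x t| ≤ C) (t a b : ℝ) :
    IntervalIntegrable (fun x => F x t) volume a b := by
  obtain ⟨C, hC⟩ := hFb t
  exact intervalIntegrable_of_bound (hF.comp measurable_prodMk_right) fun x _ => hC x t le_rfl

lemma intervalIntegrable_integral_left {F : ℝ → ℝ → ℝ} (hF : Measurable (uncurry F))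
    (hFb : ∀ T, ∃ C, ∀ x t, t ≤ T → |F x t| ≤ C) (c d a b : ℝ) :
    IntervalIntegrable (fun t => ∫ x in c..d, F x t) volume a b := by
  obtain ⟨C, hC⟩ := hFb (max a b)
  refine intervalIntegrable_of_bound (C := C * |d - c|) (measurable_integral_left hF c d)
    fun t ht => ?_
  exact intervalIntegral.norm_integral_le_of_norm_le_const (f := fun x => F x t)
    fun x _ => hC x t ht.2

lemma intervalIntegrable_integral_right {F : ℝ → ℝ → ℝ} (hF : Measurable (uncurry F))
    (hFb : ∀ T, ∃ C, ∀ x t, t ≤ T → |F x t| ≤ C) (c d a b : ℝ) :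
    IntervalIntegrable (fun x => ∫ t in c..d, F x t) volume a b := by
  obtain ⟨C, hC⟩ := hFb (max c d)
  refine intervalIntegrable_of_bound (C := C * |d - c|) (measurable_integral_right hF c d)
    fun x _ => ?_
  exact intervalIntegral.norm_integral_le_of_norm_le_const (f := F x) fun t ht => hC x t ht.2

lemma exists_bound_of_zero_outside {ξ : ℝ → ℝ} (hξ : Continuous ξ) {R : ℝ}
    (h : ∀ x, R ≤ |x| → ξ x = 0) : ∃ M, ∀ x, |ξ x| ≤ M := by
  refine hξ.bounded_above_of_compact_support (HasCompactSupport.of_support_subset_isCompact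
    (isCompact_Icc (a := -R) (b := R)) fun x hx => ?_)
  have : |x| < R := by
    by_contra! hc
    exact hx (h x hc)
  exact ⟨(abs_lt.1 this).1.le, (abs_lt.1 this).2.le⟩

lemma measurable_mul_left_bounded {ξ : ℝ → ℝ} (hξ : Continuous ξ) {M : ℝ}
    (hM : ∀ x, |ξ x| ≤ M) {F : ℝ → ℝ → ℝ} (hF : Measurable (uncurry F))
    (hFb : ∀ T, ∃ C, ∀ x t, t ≤ T → |F x t| ≤ C) :
    Measurable (uncurry fun x t => ξ x * F x t) ∧
      ∀ T, ∃ C, ∀ x t, t ≤ T → |ξ x * F x t| ≤ C := by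
  refine ⟨(hξ.measurable.comp measurable_fst).mul hF, fun T => ?_⟩
  obtain ⟨C, hC⟩ := hFb T
  refine ⟨M * C, fun x t ht => ?_⟩
  rw [abs_mul]
  exact mul_le_mul (hM x) (hC x t ht) (abs_nonneg _) ((abs_nonneg _).trans (hM x))

/-- The weak form of `V_t = W_x - F` on `ℝ × [0,∞)`. -/
def WeakEq (V W F : ℝ → ℝ → ℝ) : Prop :=
  ∀ T > (0:ℝ), ∀ φ φt φx : ℝ → ℝ → ℝ, IsTestFun T φ φt φx →
    (∫ t in Set.Ioc (0:ℝ) T, ∫ x : ℝ, φt x t * V x t)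
      = ∫ t in Set.Ioc (0:ℝ) T, ∫ x : ℝ, (φx x t * W x t + F x t * φ x t)

lemma WeakEq.integral_mul_eq {V W F : ℝ → ℝ → ℝ} (h : WeakEq V W F)
    (hV : Continuous (uncurry V)) (hW : Continuous (uncurry W)) (hF : Measurable (uncurry F))
    (hFb : ∀ T, ∃ C, ∀ x t, t ≤ T → |F x t| ≤ C)
    {R : ℝ} {ξ η : ℝ → ℝ} (hη : Continuous η) (hξη : ∀ x, HasDerivAt ξ (η x) x)
    (hξR : ∀ x, R ≤ |x| → ξ x = 0) (hηR : ∀ x, R ≤ |x| → η x = 0) {s : ℝ} (hs : 0 ≤ s) :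
    ∫ x in (-R)..R, ξ x * V x s
      = -∫ t in (0:ℝ)..s, ((∫ x in (-R)..R, η x * W x t) + ∫ x in (-R)..R, ξ x * F x t) := by
  have hξ : Continuous ξ := continuous_iff_continuousAt.2 fun x => (hξη x).continuousAt
  have hWi : ∀ t, Continuous fun x => η x * W x t := fun t =>
    hη.mul (hW.comp (continuous_id.prodMk continuous_const))
  have hFi : ∀ t, IntervalIntegrable (fun x => ξ x * F x t) volume (-R) R := fun t =>
    (intervalIntegrable_space hF hFb t _ _).continuousOn_mul hξ.continuousOn
  obtain ⟨M, hM⟩ := exists_bound_of_zero_outside hξ hξR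
  obtain ⟨hξF, hξFb⟩ := measurable_mul_left_bounded hξ hM hF hFb
  have hηW : Continuous fun t => ∫ x in (-R)..R, η x * W x t :=
    intervalIntegral.continuous_parametric_intervalIntegral_of_continuous'
      (f := fun t x => η x * W x t)
      ((hη.comp continuous_snd).mul (hW.comp (continuous_snd.prodMk continuous_fst))) _ _
  have hA : Continuous fun t => ∫ x in (-R)..R, ξ x * V x t :=
    intervalIntegral.continuous_parametric_intervalIntegral_of_continuous'
      (f := fun t x => ξ x * V x t)
      ((hξ.comp continuous_snd).mul (hV.comp (continuous_snd.prodMk continuous_fst))) _ _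
  refine eq_neg_integral_of_weak (T := s + 1) (by linarith)
    (A := fun t => ∫ x in (-R)..R, ξ x * V x t)
    (B := fun t => (∫ x in (-R)..R, η x * W x t) + ∫ x in (-R)..R, ξ x * F x t)
    hA (fun a b => (hηW.intervalIntegrable a b).add
      (intervalIntegrable_integral_left hξF hξFb _ _ a b)) ?_ ⟨hs, by linarith⟩
  intro θ hθ
  set T := s + 1
  have hT : 0 < T := by simp only [T]; linarith
  set τ : ℝ → ℝ := fun t => ∫ r in t..T, θ r with hτ
  have hτd : ∀ t, HasDerivAt τ (-θ t) t := by
    intro t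
    have : τ = fun t => -∫ r in T..t, θ r := by
      funext t; exact intervalIntegral.integral_symm _ _
    rw [this]
    exact (hθ.integral_hasStrictDerivAt T t).hasDerivAt.neg
  have hτc : Continuous τ := continuous_iff_continuousAt.2 fun x => (hτd x).continuousAt
  have htest : IsTestFun T (fun x t => ξ x * τ t) (fun x t => ξ x * -θ t)
      (fun x t => η x * τ t) := by
    refine ⟨fun x t _ => ((hτd t).const_mul (ξ x)).hasDerivWithinAt,
      fun x t _ => (hξη x).mul_const (τ t), ?_, ?_, ?_, ⟨R, fun x t _ hx => ?_⟩, fun x => ?_⟩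
    · exact Continuous.continuousOn (by fun_prop)
    · exact Continuous.continuousOn (by fun_prop)
    · exact Continuous.continuousOn (by fun_prop)
    · simp only [hξR x hx, zero_mul]
    · simp only [hτ, intervalIntegral.integral_same, mul_zero]
  have := h T hT _ _ _ htest
  rw [← intervalIntegral.integral_of_le hT.le, ← intervalIntegral.integral_of_le hT.le] at this
  convert this using 1
  · congr 1
    funext t
    rw [integral_eq_of_zero_outside (R := R) fun x hx => by simp only [hξR x hx, zero_mul],
      ← intervalIntegral.integral_const_mul]
    congr 1
    funext x
    ring
  · congr 1
    funext t
    rw [integral_eq_of_zero_outside (R := R) fun x hx => by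
        simp only [hξR x hx, hηR x hx, zero_mul, mul_zero, add_zero],
      ← intervalIntegral.integral_add ((hWi t).intervalIntegrable _ _) (hFi t),
      ← intervalIntegral.integral_const_mul]
    congr 1
    funext x
    simp only [hτ]
    ring

/-- A weak solution attains its zero initial datum. -/
lemma WeakEq.initial_eq_zero {V W F : ℝ → ℝ → ℝ} (h : WeakEq V W F)
    (hV : Continuous (uncurry V)) (hW : Continuous (uncurry W)) (hF : Measurable (uncurry F))
    (hFb : ∀ T, ∃ C, ∀ x t, t ≤ T → |F x t| ≤ C) (x : ℝ) : V x 0 = 0 := by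
  have hV0 : Continuous fun x => V x 0 := hV.comp (continuous_id.prodMk continuous_const)
  have h1 := sub_eq_integral_of_weak (W := fun _ => 0) (k := fun x => V x 0) continuous_const
    (fun a b => hV0.intervalIntegrable a b) (fun R _ ξ η hη hξη hξR hηR => by
      simpa using h.integral_mul_eq hV hW hF hFb hη hξη hξR hηR le_rfl) 0
  have h2 : HasDerivAt (fun y => ∫ x in (0:ℝ)..y, V x 0) (V x 0) x :=
    (hV0.integral_hasStrictDerivAt 0 x).hasDerivAt
  have h3 : (fun y => ∫ x in (0:ℝ)..y, V x 0) = fun _ => 0 := by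
    funext y; rw [← h1 y, sub_self]
  rw [h3] at h2
  exact h2.unique (hasDerivAt_const x 0)

/-- The balance law on rectangles. -/
lemma WeakEq.balance {V W F : ℝ → ℝ → ℝ} (h : WeakEq V W F)
    (hV : Continuous (uncurry V)) (hW : Continuous (uncurry W)) (hF : Measurable (uncurry F))
    (hFb : ∀ T, ∃ C, ∀ x t, t ≤ T → |F x t| ≤ C) {t t' : ℝ} (ht : 0 ≤ t) (htt' : t ≤ t')
    (a b : ℝ) :
    (∫ s in t..t', W b s) - ∫ s in t..t', W a s
      = ∫ x in a..b, (V x t' - V x t + ∫ s in t..t', F x s) := by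
  have hVt : ∀ t, Continuous fun x => V x t := fun t =>
    hV.comp (continuous_id.prodMk continuous_const)
  have hk : ∀ a b, IntervalIntegrable
      (fun x => V x t' - V x t + ∫ s in t..t', F x s) volume a b := fun a b =>
    (((hVt t').sub (hVt t)).intervalIntegrable a b).add
      (intervalIntegrable_integral_right hF hFb t t' a b)
  refine sub_eq_integral_of_weak (W := fun x => ∫ s in t..t', W x s)
    (intervalIntegral.continuous_parametric_intervalIntegral_of_continuous' hW t t') hk ?_ a b
  intro R hR ξ η hη hξη hξR hηR
  have hξ : Continuous ξ := continuous_iff_continuousAt.2 fun x => (hξη x).continuousAt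
  have e1 := h.integral_mul_eq hV hW hF hFb hη hξη hξR hηR ht
  have e2 := h.integral_mul_eq hV hW hF hFb hη hξη hξR hηR (ht.trans htt')
  obtain ⟨M, hM⟩ := exists_bound_of_zero_outside hξ hξR
  obtain ⟨hξF, hξFb⟩ := measurable_mul_left_bounded hξ hM hF hFb
  have hηWc : Continuous (uncurry fun x t => η x * W x t) := (hη.comp continuous_fst).mul hW
  have hηW : Continuous fun t => ∫ x in (-R)..R, η x * W x t :=
    intervalIntegral.continuous_parametric_intervalIntegral_of_continuous'
      (f := fun t x => η x * W x t) (hηWc.comp continuous_swap) _ _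
  have hηW' : Continuous fun x => ∫ t in t..t', η x * W x t :=
    intervalIntegral.continuous_parametric_intervalIntegral_of_continuous' hηWc _ _
  have hP : ∀ a b, IntervalIntegrable (fun s => (∫ x in (-R)..R, η x * W x s)
      + ∫ x in (-R)..R, ξ x * F x s) volume a b := fun a b =>
    (hηW.intervalIntegrable a b).add (intervalIntegrable_integral_left hξF hξFb _ _ a b)
  have e3 := intervalIntegral.integral_add_adjacent_intervals (hP 0 t) (hP t t')
  rw [intervalIntegral.integral_add (a := t) (hηW.intervalIntegrable _ _)
    (intervalIntegrable_integral_left hξF hξFb _ _ _ _)] at e3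
  have s1 : ∫ s in t..t', ∫ x in (-R)..R, η x * W x s
      = ∫ x in (-R)..R, ∫ s in t..t', η x * W x s := by
    symm
    apply intervalIntegral_intervalIntegral_swap
    exact (hηWc.continuousOn.integrableOn_compact (isCompact_uIcc.prod isCompact_uIcc)).mono_set
      (prod_mono uIoc_subset_uIcc uIoc_subset_uIcc)
  have s2 : ∫ s in t..t', ∫ x in (-R)..R, ξ x * F x s
      = ∫ x in (-R)..R, ∫ s in t..t', ξ x * F x s := by
    symm
    exact intervalIntegral_intervalIntegral_swap (integrableOn_rect hξF hξFb _ _ _ _)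
  have hsplit : ∀ x, η x * (∫ s in t..t', W x s) + ξ x * (V x t' - V x t + ∫ s in t..t', F x s)
      = ((∫ s in t..t', η x * W x s) + ξ x * V x t' - ξ x * V x t)
        + ∫ s in t..t', ξ x * F x s := by
    intro x
    rw [intervalIntegral.integral_const_mul, intervalIntegral.integral_const_mul]
    ring
  have hξV : ∀ t, Continuous fun x => ξ x * V x t := fun t => hξ.mul (hVt t)
  have c1 : Continuous fun x => (∫ s in t..t', η x * W x s) + ξ x * V x t' := hηW'.add (hξV t')
  have c2 : Continuous fun x => (∫ s in t..t', η x * W x s) + ξ x * V x t' - ξ x * V x t :=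
    c1.sub (hξV t)
  simp only [hsplit]
  rw [intervalIntegral.integral_add (c2.intervalIntegrable _ _)
      (intervalIntegrable_integral_right hξF hξFb _ _ _ _),
    intervalIntegral.integral_sub (c1.intervalIntegrable _ _) ((hξV t).intervalIntegrable _ _),
    intervalIntegral.integral_add (hηW'.intervalIntegrable _ _)
      ((hξV t').intervalIntegrable _ _)]
  linarith

end Rectangle

section MaximumPrinciple

open Function

/-- Maximum principle on the quarter plane for continuous functions satisfying the strict
heat inequality in integrated form wherever they are positive. -/
lemma nonpos_of_strict_balance {D q : ℝ → ℝ → ℝ} (hD : Continuous (uncurry D))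
    (hq : Continuous (uncurry q)) (hDq : ∀ x t, HasDerivAt (fun y => D y t) (q x t) x)
    {t₁ T R κ : ℝ} (hκ : 0 < κ)
    (hbal : ∀ t t' a b, t₁ ≤ t → t ≤ t' → 0 ≤ a → a ≤ b →
      (∀ x ∈ Icc a b, ∀ s ∈ Icc t t', 0 < D x s) →
      (∫ x in a..b, (D x t' - D x t)) + κ * (b - a) * (t' - t)
        ≤ (∫ s in t..t', q b s) - ∫ s in t..t', q a s)
    (hq0 : ∀ t, t₁ ≤ t → 0 ≤ q 0 t) (hinit : ∀ x, 0 ≤ x → D x t₁ ≤ 0)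
    (hfar : ∀ x t, R ≤ x → t ∈ Icc t₁ T → D x t ≤ 0) {x t : ℝ} (hx : 0 ≤ x)
    (ht : t ∈ Icc t₁ T) : D x t ≤ 0 := by
  by_contra! hpos
  have hxR : x < R := by
    by_contra! hc
    exact absurd (hfar x t hc ht) (not_le.2 hpos)
  have hDx : ∀ x, Continuous (D x) := fun x => hD.comp (Continuous.prodMk_right x)
  have hDt : ∀ t, Continuous fun x => D x t := fun t => hD.comp (Continuous.prodMk_left t)
  have hqx : ∀ x, Continuous (q x) := fun x => hq.comp (Continuous.prodMk_right x)
  set μ := D x t / 4 with hμdef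
  have hμ : 0 < μ := by positivity
  have hunif : UniformContinuousOn (uncurry D) (Icc 0 R ×ˢ Icc t₁ (T + 1)) :=
    (isCompact_Icc.prod isCompact_Icc).uniformContinuousOn_of_continuous hD.continuousOn
  obtain ⟨δ, hδ, hδμ⟩ := Metric.uniformContinuousOn_iff.1 hunif μ hμ
  have hclose : ∀ x ∈ Icc 0 R, ∀ y ∈ Icc 0 R, ∀ s ∈ Icc t₁ (T + 1), ∀ r ∈ Icc t₁ (T + 1),
      |x - y| < δ → |s - r| < δ → |D x s - D y r| < μ := by
    intro x hx y hy s hs r hr h1 h2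
    have := hδμ (x, s) ⟨hx, hs⟩ (y, r) ⟨hy, hr⟩ (by
      rw [Prod.dist_eq, max_lt_iff]; exact ⟨h1, h2⟩)
    exact this
  obtain ⟨h, hh, hhδ, hh1⟩ : ∃ h > (0:ℝ), h < δ ∧ h ≤ 1 :=
    ⟨min (δ / 2) 1, by positivity, (min_le_left _ _).trans_lt (by linarith), min_le_right _ _⟩
  set J : ℝ → ℝ → ℝ := fun x t => ∫ s in t..t + h, D x s with hJdef
  have hprim : Continuous fun p : ℝ × ℝ => ∫ s in (0:ℝ)..p.2, D p.1 s :=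
    intervalIntegral.continuous_parametric_primitive_of_continuous hD
  have hJ' : ∀ x t, J x t = (∫ s in (0:ℝ)..t + h, D x s) - ∫ s in (0:ℝ)..t, D x s := fun x t =>
    (intervalIntegral.integral_interval_sub_left ((hDx x).intervalIntegrable _ _)
      ((hDx x).intervalIntegrable _ _)).symm
  have hJc : Continuous (uncurry J) := by
    have : uncurry J = fun p : ℝ × ℝ =>
        (∫ s in (0:ℝ)..p.2 + h, D p.1 s) - ∫ s in (0:ℝ)..p.2, D p.1 s := by
      funext p; exact hJ' p.1 p.2
    rw [this]
    exact (hprim.comp (continuous_fst.prodMk (continuous_snd.add continuous_const))).sub hprim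
  have hJD : ∀ x ∈ Icc 0 R, ∀ t ∈ Icc t₁ T, |J x t - h * D x t| ≤ μ * h := by
    intro x hx t ht
    have e : J x t - h * D x t = ∫ s in t..t + h, (D x s - D x t) := by
      rw [intervalIntegral.integral_sub ((hDx x).intervalIntegrable _ _)
        (continuous_const.intervalIntegrable _ _), intervalIntegral.integral_const, smul_eq_mul,
        add_sub_cancel_left]
    rw [e]
    have := intervalIntegral.norm_integral_le_of_norm_le_const (a := t) (b := t + h) (C := μ)
      (f := fun s => D x s - D x t) (fun s hs => by
        rw [uIoc_of_le (by linarith)] at hs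
        refine (hclose x hx x hx s ⟨?_, ?_⟩ t ⟨ht.1, ?_⟩ (by simpa using hδ) ?_).le
        · linarith [hs.1, ht.1]
        · linarith [hs.2, ht.2]
        · linarith [ht.2]
        · rw [abs_lt]; constructor <;> linarith [hs.1, hs.2])
    rwa [add_sub_cancel_left, abs_of_pos hh] at this
  obtain ⟨⟨x₀, t₀⟩, ⟨hx₀, ht₀⟩, hmax⟩ := (isCompact_Icc.prod isCompact_Icc).exists_isMaxOn
    (s := Icc 0 R ×ˢ Icc t₁ T) ⟨(x, t), ⟨hx, hxR.le⟩, ht⟩ hJc.continuousOn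
  have hmax' : ∀ x ∈ Icc 0 R, ∀ t ∈ Icc t₁ T, J x t ≤ J x₀ t₀ := fun x hx t ht =>
    hmax (show (x, t) ∈ Icc 0 R ×ˢ Icc t₁ T from ⟨hx, ht⟩)
  simp only at hx₀ ht₀
  have hD0 : 2 * μ ≤ D x₀ t₀ := by
    have h1 := (abs_le.1 (hJD x ⟨hx, hxR.le⟩ t ht)).1
    have h2 := (abs_le.1 (hJD x₀ hx₀ t₀ ht₀)).2
    have h3 := hmax' x ⟨hx, hxR.le⟩ t ht
    have : h * (2 * μ) ≤ h * D x₀ t₀ := by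
      rw [show D x t = 4 * μ by simp only [hμdef]; ring] at h1
      nlinarith
    exact le_of_mul_le_mul_left this hh
  have hx₀R : x₀ < R := by
    by_contra! hc
    linarith [hfar x₀ t₀ hc ht₀]
  have ht₀1 : t₁ < t₀ := by
    refine lt_of_le_of_ne ht₀.1 fun hc => ?_
    rw [← hc] at hD0
    linarith [hinit x₀ hx₀.1]
  -- the time derivative is nonnegative at the maximum
  have htime : 0 ≤ D x₀ (t₀ + h) - D x₀ t₀ := by
    have hd : HasDerivAt (J x₀) (D x₀ (t₀ + h) - D x₀ t₀) t₀ := by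
      have : J x₀ = fun t => (∫ s in (0:ℝ)..t + h, D x₀ s) - ∫ s in (0:ℝ)..t, D x₀ s := by
        funext t; exact hJ' x₀ t
      rw [this]
      exact (((hDx x₀).integral_hasStrictDerivAt 0 (t₀ + h)).hasDerivAt.comp_add_const t₀ h).sub
        ((hDx x₀).integral_hasStrictDerivAt 0 t₀).hasDerivAt
    have hs := (hasDerivWithinAt_iff_tendsto_slope' (by simp)).1 (hd.hasDerivWithinAt (s := Iio t₀))
    refine ge_of_tendsto hs ?_
    filter_upwards [Ioo_mem_nhdsLT ht₀1] with s hs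
    rw [slope_def_field]
    have := hmax' x₀ hx₀ s ⟨hs.1.le, hs.2.le.trans ht₀.2⟩
    exact div_nonneg_of_nonpos (by linarith) (by linarith [hs.2])
  -- the space derivative
  set Q : ℝ → ℝ := fun x => ∫ s in t₀..t₀ + h, q x s with hQdef
  have hQ : Continuous Q :=
    intervalIntegral.continuous_parametric_intervalIntegral_of_continuous' hq _ _
  have hJQ : ∀ a b, ∫ x in a..b, Q x = J b t₀ - J a t₀ := by
    intro a b
    simp only [hQdef, hJdef]
    rw [intervalIntegral_intervalIntegral_swap, ← intervalIntegral.integral_sub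
      ((hDx b).intervalIntegrable _ _) ((hDx a).intervalIntegrable _ _)]
    · congr 1
      funext s
      exact intervalIntegral.integral_eq_sub_of_hasDerivAt (fun x _ => hDq x s)
        ((hq.comp (Continuous.prodMk_left s)).intervalIntegrable _ _)
    · exact (hq.continuousOn.integrableOn_compact (isCompact_uIcc.prod isCompact_uIcc)).mono_set
        (prod_mono uIoc_subset_uIcc uIoc_subset_uIcc)
  have hspace : 0 ≤ Q x₀ := by
    rcases hx₀.1.eq_or_lt with h0 | h0
    · rw [← h0]
      exact intervalIntegral.integral_nonneg (by linarith) fun s hs => hq0 s (by linarith [hs.1])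
    · have hd : HasDerivAt (fun x => J x t₀) (Q x₀) x₀ := by
        have : (fun x => J x t₀) = fun x => (∫ y in (0:ℝ)..x, Q y) + J 0 t₀ := by
          funext x; rw [hJQ]; ring
        rw [this]
        exact (hQ.integral_hasStrictDerivAt 0 x₀).hasDerivAt.add_const _
      have hloc : IsLocalMax (fun x => J x t₀) x₀ := by
        filter_upwards [Ioo_mem_nhds h0 hx₀R] with y hy
        exact hmax' y ⟨hy.1.le, hy.2.le⟩ t₀ ht₀
      exact (hloc.hasDerivAt_eq_zero hd).ge
  have hev : ∀ᶠ y in nhds x₀, -(κ * h / 2) < D y (t₀ + h) - D y t₀ := by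
    have hc : Continuous fun y => D y (t₀ + h) - D y t₀ := (hDt _).sub (hDt _)
    have hκh : 0 < κ * h := by positivity
    exact hc.continuousAt.eventually_const_lt (by linarith)
  obtain ⟨r', hr', hr'ev⟩ := Metric.eventually_nhds_iff.1 hev
  obtain ⟨r, hr, hrr', hrδ, hrR⟩ : ∃ r > (0:ℝ), r < r' ∧ r < δ ∧ x₀ + r ≤ R := by
    refine ⟨min (min (r' / 2) (δ / 2)) (R - x₀), ?_, ?_, ?_, ?_⟩
    · exact lt_min (by positivity) (by linarith)
    · exact ((min_le_left _ _).trans (min_le_left _ _)).trans_lt (by linarith)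
    · exact ((min_le_left _ _).trans (min_le_right _ _)).trans_lt (by linarith)
    · linarith [min_le_right (min (r' / 2) (δ / 2)) (R - x₀)]
  have hQpos : ∀ b ∈ Ioo x₀ (x₀ + r), 0 < Q b := by
    intro b hb
    have h1 := hbal t₀ (t₀ + h) x₀ b ht₀.1 (by linarith) hx₀.1 hb.1.le (by
      intro y hy s hs
      have := hclose y ⟨hx₀.1.trans hy.1, by linarith [hy.2, hb.2]⟩ x₀ hx₀ s
        ⟨by linarith [hs.1], by linarith [hs.2, ht₀.2]⟩ t₀ ⟨ht₀.1, by linarith [ht₀.2]⟩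
        (by rw [abs_lt]; constructor <;> linarith [hy.1, hy.2, hb.2])
        (by rw [abs_lt]; constructor <;> linarith [hs.1, hs.2])
      linarith [(abs_lt.1 this).1])
    have h2 : ∫ _ in x₀..b, -(κ * h / 2) ≤ ∫ y in x₀..b, (D y (t₀ + h) - D y t₀) := by
      refine intervalIntegral.integral_mono_on hb.1.le (continuous_const.intervalIntegrable _ _)
        (((hDt _).sub (hDt _)).intervalIntegrable _ _) fun y hy => (hr'ev ?_).le
      rw [Real.dist_eq, abs_lt]
      constructor <;> linarith [hy.1, hy.2, hb.2]
    rw [intervalIntegral.integral_const, smul_eq_mul] at h2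
    have h3 : 0 < (b - x₀) * (κ * h) := mul_pos (by linarith [hb.1]) (by positivity)
    simp only [hQdef] at hspace ⊢
    nlinarith
  have hlast : 0 < ∫ y in x₀..x₀ + r, Q y :=
    intervalIntegral.intervalIntegral_pos_of_pos_on (hQ.intervalIntegrable _ _) hQpos (by linarith)
  rw [hJQ] at hlast
  linarith [hmax' (x₀ + r) ⟨by linarith [hx₀.1], hrR⟩ t₀ ht₀]

/-- Comparison of a solution of the balance law with a classical supersolution on the
quarter plane. -/
lemma le_of_supersolution {V W F : ℝ → ℝ → ℝ} (hV : Continuous (uncurry V))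
    (hW : Continuous (uncurry W)) (hVW : ∀ x t, HasDerivAt (fun y => V y t) (W x t) x)
    (hF : Measurable (uncurry F)) (hFb : ∀ T, ∃ C, ∀ x t, t ≤ T → |F x t| ≤ C)
    (hVb : ∀ T, ∃ C, ∀ x t, t ≤ T → |V x t| ≤ C) (hW0 : ∀ t, W 0 t = 0)
    (hbal : ∀ t t', 0 ≤ t → t ≤ t' → ∀ a b, (∫ s in t..t', W b s) - ∫ s in t..t', W a s
      = ∫ x in a..b, (V x t' - V x t + ∫ s in t..t', F x s))
    {B Bx Bxx Bt : ℝ → ℝ → ℝ} {t₁ C : ℝ} (ht₁ : 0 ≤ t₁) (hB : Continuous (uncurry B))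
    (hBx : Continuous (uncurry Bx)) (hBxx : Continuous (uncurry Bxx))
    (hBt : Continuous (uncurry Bt)) (hBdx : ∀ x t, HasDerivAt (fun y => B y t) (Bx x t) x)
    (hBdxx : ∀ x t, HasDerivAt (fun y => Bx y t) (Bxx x t) x)
    (hBdt : ∀ x t, t₁ < t → HasDerivAt (B x) (Bt x t) t)
    (hBC : ∀ x t, 0 ≤ x → C ≤ B x t) (hB0 : ∀ t, t₁ ≤ t → Bx 0 t ≤ 0)
    (hinit : ∀ x, 0 ≤ x → V x t₁ ≤ B x t₁)
    (hsuper : ∀ x t, 0 ≤ x → t₁ ≤ t → B x t < V x t → Bxx x t - Bt x t ≤ F x t)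
    {x t : ℝ} (hx : 0 ≤ x) (ht : t₁ ≤ t) : V x t ≤ B x t := by
  have main : ∀ ε > 0, V x t - (B x t + ε * (x ^ 2 + 3 * (t - t₁))) ≤ 0 := by
    intro ε hε
    obtain ⟨C', hC'⟩ := hVb t
    refine nonpos_of_strict_balance
      (D := fun x t => V x t - (B x t + ε * (x ^ 2 + 3 * (t - t₁))))
      (q := fun x t => W x t - (Bx x t + ε * (2 * x))) (t₁ := t₁) (T := t)
      (R := max 1 ((|C| + |C'|) / ε)) (κ := ε) ?_ ?_ ?_ hε ?_ ?_ ?_ ?_ hx ⟨ht, le_rfl⟩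
    · exact hV.sub (hB.add (by fun_prop))
    · exact hW.sub (hBx.add (by fun_prop))
    · intro x t
      refine (hVW x t).sub ((hBdx x t).add ?_)
      have h2 := (((hasDerivAt_id x).pow 2).add_const (3 * (t - t₁))).const_mul ε
      simpa using h2
    · intro t t' a b ht htt' ha hab hpos
      have cW : ∀ x, Continuous (W x) := fun x => hW.comp (Continuous.prodMk_right x)
      have cBx : ∀ x, Continuous (Bx x) := fun x => hBx.comp (Continuous.prodMk_right x)
      have cBxx : ∀ x, Continuous (Bxx x) := fun x => hBxx.comp (Continuous.prodMk_right x)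
      have cBt : ∀ x, Continuous (Bt x) := fun x => hBt.comp (Continuous.prodMk_right x)
      have cB : ∀ x, Continuous (B x) := fun x => hB.comp (Continuous.prodMk_right x)
      have cVs : ∀ s, Continuous fun x => V x s := fun s => hV.comp (Continuous.prodMk_left s)
      have cBs : ∀ s, Continuous fun x => B x s := fun s => hB.comp (Continuous.prodMk_left s)
      have hq : ∀ x, ∫ s in t..t', (W x s - (Bx x s + ε * (2 * x)))
          = (∫ s in t..t', W x s) - (∫ s in t..t', Bx x s) - (t' - t) * (ε * (2 * x)) := by
        intro x
        have i1 : IntervalIntegrable (fun s => Bx x s + ε * (2 * x)) volume t t' :=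
          ((cBx x).add continuous_const).intervalIntegrable _ _
        rw [intervalIntegral.integral_sub ((cW x).intervalIntegrable _ _) i1,
          intervalIntegral.integral_add ((cBx x).intervalIntegrable _ _)
            (continuous_const.intervalIntegrable _ _), intervalIntegral.integral_const, smul_eq_mul]
        ring
      have hBB : (∫ s in t..t', Bx b s) - ∫ s in t..t', Bx a s
          = ∫ x in a..b, ∫ s in t..t', Bxx x s := by
        rw [intervalIntegral_intervalIntegral_swap, ← intervalIntegral.integral_sub
          ((cBx b).intervalIntegrable _ _) ((cBx a).intervalIntegrable _ _)]
        · congr 1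
          funext s
          exact (intervalIntegral.integral_eq_sub_of_hasDerivAt (fun x _ => hBdxx x s)
            ((hBxx.comp (Continuous.prodMk_left s)).intervalIntegrable _ _)).symm
        · exact (hBxx.continuousOn.integrableOn_compact
            (isCompact_uIcc.prod isCompact_uIcc)).mono_set
              (prod_mono uIoc_subset_uIcc uIoc_subset_uIcc)
      have cIxx : Continuous fun x => ∫ s in t..t', Bxx x s :=
        intervalIntegral.continuous_parametric_intervalIntegral_of_continuous' hBxx _ _
      have iF : IntervalIntegrable (fun x => V x t' - V x t + ∫ s in t..t', F x s) volume a b :=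
        (((cVs t').sub (cVs t)).intervalIntegrable _ _).add
          (intervalIntegrable_integral_right hF hFb _ _ _ _)
      have hpt : ∀ x ∈ Icc a b, -(B x t' - B x t) ≤
          (∫ s in t..t', F x s) - ∫ s in t..t', Bxx x s := by
        intro x hx
        have e1 : ∫ s in t..t', Bt x s = B x t' - B x t :=
          intervalIntegral.integral_eq_sub_of_hasDerivAt_of_le htt' (cB x).continuousOn
            (fun s hs => hBdt x s (ht.trans_lt hs.1)) ((cBt x).intervalIntegrable _ _)
        have e2 : ∫ s in t..t', (Bxx x s - Bt x s) ≤ ∫ s in t..t', F x s := by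
          refine intervalIntegral.integral_mono_on htt'
            (((cBxx x).sub (cBt x)).intervalIntegrable _ _)
            (intervalIntegrable_time hF hFb x t t') fun s hs => ?_
          have hs1 : t₁ ≤ s := ht.trans hs.1
          refine hsuper x s (ha.trans hx.1) hs1 ?_
          have h1 := hpos x hx s hs
          have h2 : 0 ≤ ε * (x ^ 2 + 3 * (s - t₁)) :=
            mul_nonneg hε.le (by nlinarith [sq_nonneg x])
          linarith
        rw [intervalIntegral.integral_sub ((cBxx x).intervalIntegrable _ _)
          ((cBt x).intervalIntegrable _ _), e1] at e2
        linarith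
      have hmono : ∫ x in a..b, ((V x t' - V x t) - (B x t' - B x t)) ≤
          ∫ x in a..b, ((V x t' - V x t + ∫ s in t..t', F x s) - ∫ s in t..t', Bxx x s) := by
        refine intervalIntegral.integral_mono_on hab
          ((((cVs t').sub (cVs t)).sub ((cBs t').sub (cBs t))).intervalIntegrable _ _)
          (iF.sub (cIxx.intervalIntegrable _ _)) fun x hx => ?_
        linarith [hpt x hx]
      rw [intervalIntegral.integral_sub iF (cIxx.intervalIntegrable _ _),
        ← hbal t t' (ht₁.trans ht) htt' a b, ← hBB] at hmono
      have hsplit : ∀ x, (V x t' - (B x t' + ε * (x ^ 2 + 3 * (t' - t₁))))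
          - (V x t - (B x t + ε * (x ^ 2 + 3 * (t - t₁))))
          = ((V x t' - V x t) - (B x t' - B x t)) - 3 * ε * (t' - t) := fun x => by ring
      have i2 : IntervalIntegrable (fun x => (V x t' - V x t) - (B x t' - B x t)) volume a b :=
        (((cVs t').sub (cVs t)).sub ((cBs t').sub (cBs t))).intervalIntegrable _ _
      simp only [hsplit]
      rw [hq, hq, intervalIntegral.integral_sub i2 (continuous_const.intervalIntegrable _ _),
        intervalIntegral.integral_const, smul_eq_mul]
      linarith
    · intro t ht
      rw [hW0]
      linarith [hB0 t ht]
    · intro x hx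
      have := hinit x hx
      have h2 : 0 ≤ ε * (x ^ 2 + 3 * (t₁ - t₁)) := by rw [sub_self]; positivity
      linarith
    · intro x s hx hs
      have h1 : 1 ≤ x := (le_max_left _ _).trans hx
      have h2 : |C| + |C'| ≤ x * ε := (div_le_iff₀ hε).1 ((le_max_right _ _).trans hx)
      have h3 : V x s ≤ C' := (abs_le.1 (hC' x s hs.2)).2
      have h4 := hBC x s (by linarith)
      have h5 : x * ε ≤ ε * (x ^ 2 + 3 * (s - t₁)) := by
        rw [mul_comm]
        exact mul_le_mul_of_nonneg_left (by nlinarith [hs.1]) hε.le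
      linarith [le_abs_self C', neg_abs_le C]
  have hc : 0 ≤ x ^ 2 + 3 * (t - t₁) := by nlinarith [sq_nonneg x]
  refine le_of_forall_pos_le_add fun ε hε => ?_
  have h1 := main (ε / (x ^ 2 + 3 * (t - t₁) + 1)) (by positivity)
  have h2 : ε / (x ^ 2 + 3 * (t - t₁) + 1) * (x ^ 2 + 3 * (t - t₁)) ≤ ε := by
    rw [div_mul_eq_mul_div, div_le_iff₀ (by positivity)]
    nlinarith
  linarith

end MaximumPrinciple

section ErrorFunction

lemma integrable_exp_neg_sq : Integrable fun s : ℝ => Real.exp (-s ^ 2) := by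
  simpa using integrable_exp_neg_mul_sq (b := 1) one_pos

lemma erf_add_erfc (x : ℝ) : erf x + erfc x = 1 := by
  have h0 : ∫ s in Ioi (0:ℝ), Real.exp (-s ^ 2) = Real.sqrt Real.pi / 2 := by
    simpa using integral_gaussian_Ioi 1
  have h1 := intervalIntegral.integral_interval_add_Ioi (a := 0) (b := x)
    integrable_exp_neg_sq.integrableOn integrable_exp_neg_sq.integrableOn
  rw [erf, erfc, ← mul_add, h1, h0]
  have : 0 < Real.sqrt Real.pi := Real.sqrt_pos.2 Real.pi_pos
  field_simp

lemma erfc_eq_one_sub (x : ℝ) : erfc x = 1 - erf x := by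
  linarith [erf_add_erfc x]

lemma hasDerivAt_erfc (x : ℝ) :
    HasDerivAt erfc (-(2 / Real.sqrt Real.pi * Real.exp (-x ^ 2))) x := by
  have h : erfc = fun x => 1 - erf x := funext erfc_eq_one_sub
  have hc : Continuous fun s : ℝ => Real.exp (-s ^ 2) := by fun_prop
  rw [h, ← zero_sub]
  exact (hasDerivAt_const x 1).sub
    ((hc.integral_hasStrictDerivAt 0 x).hasDerivAt.const_mul _)

lemma continuous_erfc : Continuous erfc :=
  continuous_iff_continuousAt.2 fun x => (hasDerivAt_erfc x).continuousAt

lemma two_div_sqrt_pi_pos : 0 < 2 / Real.sqrt Real.pi :=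
  div_pos two_pos (Real.sqrt_pos.2 Real.pi_pos)

lemma erfc_strictAnti : StrictAnti erfc :=
  strictAnti_of_hasDerivAt_neg hasDerivAt_erfc fun _ =>
    neg_neg_of_pos (mul_pos two_div_sqrt_pi_pos (Real.exp_pos _))

lemma erfc_nonneg (x : ℝ) : 0 ≤ erfc x :=
  mul_nonneg two_div_sqrt_pi_pos.le (integral_nonneg fun _ => (Real.exp_pos _).le)

lemma erfc_pos (x : ℝ) : 0 < erfc x :=
  (erfc_nonneg (x + 1)).trans_lt (erfc_strictAnti (by linarith))

lemma erfc_zero : erfc 0 = 1 := by simp [erfc_eq_one_sub, erf]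

lemma erfc_le_one {x : ℝ} (hx : 0 ≤ x) : erfc x ≤ 1 :=
  erfc_zero ▸ erfc_strictAnti.antitone hx

lemma erf_nonneg {x : ℝ} (hx : 0 ≤ x) : 0 ≤ erf x := by
  linarith [erf_add_erfc x, erfc_le_one hx]

lemma erf_pos {x : ℝ} (hx : 0 < x) : 0 < erf x := by
  linarith [erf_add_erfc x, erfc_zero, erfc_strictAnti hx]

lemma erfc_le_exp {x : ℝ} (hx : 0 ≤ x) : erfc x ≤ Real.exp (-x ^ 2) := by
  have h0 : ∫ s in Ioi (0:ℝ), Real.exp (-s ^ 2) = Real.sqrt Real.pi / 2 := by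
    simpa using integral_gaussian_Ioi 1
  have h1 : ∫ s in Ioi x, Real.exp (-s ^ 2) = ∫ s in Ioi (0:ℝ), Real.exp (-(s + x) ^ 2) := by
    have := (measurePreserving_add_right volume x).setIntegral_preimage_emb
      (measurableEmbedding_addRight x) (fun s : ℝ => Real.exp (-s ^ 2)) (Ioi x)
    simpa using this.symm
  have h2 : ∫ s in Ioi (0:ℝ), Real.exp (-(s + x) ^ 2) ≤
      ∫ s in Ioi (0:ℝ), Real.exp (-x ^ 2) * Real.exp (-s ^ 2) := by
    refine setIntegral_mono_on (integrable_exp_neg_sq.comp_add_right x).integrableOn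
      (integrable_exp_neg_sq.const_mul _).integrableOn measurableSet_Ioi fun s hs => ?_
    rw [← Real.exp_add]
    refine Real.exp_le_exp.2 ?_
    nlinarith [mul_nonneg (le_of_lt hs) hx]
  rw [integral_const_mul, h0, ← h1] at h2
  have hpi : 0 < Real.sqrt Real.pi := Real.sqrt_pos.2 Real.pi_pos
  calc erfc x ≤ 2 / Real.sqrt Real.pi * (Real.exp (-x ^ 2) * (Real.sqrt Real.pi / 2)) :=
        mul_le_mul_of_nonneg_left h2 two_div_sqrt_pi_pos.le
    _ = Real.exp (-x ^ 2) := by field_simp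

lemma tendsto_erfc_atTop : Tendsto erfc atTop (nhds 0) := by
  refine squeeze_zero' (g := fun x => Real.exp (-x)) (Eventually.of_forall erfc_nonneg) ?_
    Real.tendsto_exp_neg_atTop_nhds_zero
  filter_upwards [eventually_ge_atTop 1] with x hx
  exact (erfc_le_exp (by linarith)).trans (Real.exp_le_exp.2 (by nlinarith))

/-- Quantitative scaling estimate for the complementary error function. -/
lemma erfc_mul_sub_le {y ρ : ℝ} (hy : 0 ≤ y) (hρ : 0 < ρ) (hρ1 : ρ ≤ 1) :
    erfc (ρ * y) - erfc y ≤ 2 / Real.sqrt Real.pi * ((1 - ρ) / ρ) := by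
  have hd : ∀ x ∈ interior (Icc (ρ * y) y), -(2 / Real.sqrt Real.pi * Real.exp (-(ρ * y) ^ 2))
      ≤ deriv erfc x := by
    intro x hx
    rw [interior_Icc] at hx
    rw [(hasDerivAt_erfc x).deriv, neg_le_neg_iff]
    refine mul_le_mul_of_nonneg_left (Real.exp_le_exp.2 ?_) two_div_sqrt_pi_pos.le
    nlinarith [hx.1, mul_nonneg hρ.le hy]
  have hy1 : ρ * y ≤ y := by nlinarith
  have h1 := (convex_Icc (ρ * y) y).mul_sub_le_image_sub_of_le_deriv
    continuous_erfc.continuousOn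
    (fun x _ => (hasDerivAt_erfc x).differentiableAt.differentiableWithinAt) hd (ρ * y)
    ⟨le_rfl, hy1⟩ y ⟨hy1, le_rfl⟩ hy1
  have h2 : ρ * y * Real.exp (-(ρ * y) ^ 2) ≤ 1 := by
    have h3 : ρ * y ≤ Real.exp ((ρ * y) ^ 2) := by
      nlinarith [Real.add_one_le_exp ((ρ * y) ^ 2), sq_nonneg (ρ * y - 1)]
    rw [Real.exp_neg, ← div_eq_mul_inv]
    exact (div_le_one (Real.exp_pos _)).2 h3
  have h4 : (1 - ρ) / ρ * (ρ * y * Real.exp (-(ρ * y) ^ 2)) ≤ (1 - ρ) / ρ * 1 :=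
    mul_le_mul_of_nonneg_left h2 (div_nonneg (by linarith) hρ.le)
  have h5 : (1 - ρ) / ρ * (ρ * y * Real.exp (-(ρ * y) ^ 2))
      = (y - ρ * y) * Real.exp (-(ρ * y) ^ 2) := by field_simp
  have h6 := mul_le_mul_of_nonneg_left (h5 ▸ h4) two_div_sqrt_pi_pos.le
  linarith

end ErrorFunction

section Profiles

lemma integral_Ioi_exp_neg_sq_div_four (m : ℝ) :
    ∫ ζ in Ioi m, Real.exp (-ζ ^ 2 / 4) = Real.sqrt Real.pi * erfc (m / 2) := by
  have h := integral_comp_mul_left_Ioi (fun s : ℝ => Real.exp (-s ^ 2)) m (b := 1 / 2) (by norm_num)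
  have e : (fun ζ : ℝ => Real.exp (-ζ ^ 2 / 4)) = fun ζ => Real.exp (-(1 / 2 * ζ) ^ 2) := by
    funext ζ; congr 1; ring
  rw [e, h, erfc, smul_eq_mul, show 1 / 2 * m = m / 2 by ring]
  have : 0 < Real.sqrt Real.pi := Real.sqrt_pos.2 Real.pi_pos
  field_simp

lemma PsiP_eq (α β η : ℝ) : PsiP α β η =
    α * β / 2 * Real.exp (α ^ 2 / 4) * Real.sqrt Real.pi * erfc (max η α / 2) := by
  rw [PsiP, integral_Ioi_exp_neg_sq_div_four]
  ring

lemma psi_of_pos {α β x t : ℝ} (ht : 0 < t) : psi α β x t = PsiP α β (|x| / Real.sqrt t) := by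
  rw [psi, if_pos ht, PsiP]

lemma psi_zero_right (α β x : ℝ) : psi α β x 0 = 0 := by simp [psi]

lemma psi_neg_left (α β x t : ℝ) : psi α β (-x) t = psi α β x t := by simp [psi]

lemma PsiP_antitone {α β : ℝ} (hα : 0 < α) (hβ : 0 < β) : Antitone (PsiP α β) := by
  intro x y hxy
  rw [PsiP_eq, PsiP_eq]
  refine mul_le_mul_of_nonneg_left (erfc_strictAnti.antitone ?_) (by positivity)
  gcongr

lemma PsiP_nonneg {α β : ℝ} (hα : 0 < α) (hβ : 0 < β) (η : ℝ) : 0 ≤ PsiP α β η := by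
  rw [PsiP_eq]
  have := erfc_nonneg (max η α / 2)
  positivity

lemma PsiP_of_le {α β η : ℝ} (h : η ≤ α) : PsiP α β η = PsiP α β α := by
  rw [PsiP, PsiP, max_eq_right h, max_self]

lemma PsiP_le {α β : ℝ} (hα : 0 < α) (hβ : 0 < β) (η : ℝ) : PsiP α β η ≤ PsiP α β α := by
  rcases le_total η α with h | h
  · exact (PsiP_of_le h).le
  · exact PsiP_antitone hα hβ h

lemma tendsto_PsiP_atTop (α β : ℝ) : Tendsto (PsiP α β) atTop (nhds 0) := by
  have h : Tendsto (fun η : ℝ => max η α / 2) atTop atTop :=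
    (tendsto_atTop_mono (fun η => le_max_left η α) tendsto_id).atTop_div_const two_pos
  have := (tendsto_erfc_atTop.comp h).const_mul
    (α * β / 2 * Real.exp (α ^ 2 / 4) * Real.sqrt Real.pi)
  rw [mul_zero] at this
  exact this.congr fun η => (PsiP_eq α β η).symm

lemma psi_nonneg {α β : ℝ} (hα : 0 < α) (hβ : 0 < β) {x t : ℝ} (ht : 0 ≤ t) :
    0 ≤ psi α β x t := by
  rcases ht.eq_or_lt with rfl | h
  · exact (psi_zero_right α β x).ge
  · rw [psi_of_pos h]; exact PsiP_nonneg hα hβ _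

lemma psi_le {α β : ℝ} (hα : 0 < α) (hβ : 0 < β) {x t : ℝ} (ht : 0 ≤ t) :
    psi α β x t ≤ PsiP α β α := by
  rcases ht.eq_or_lt with rfl | h
  · rw [psi_zero_right]; exact PsiP_nonneg hα hβ _
  · rw [psi_of_pos h]; exact PsiP_le hα hβ _

lemma psi_of_le {α β x t : ℝ} (ht : 0 < t) (h : |x| ≤ α * Real.sqrt t) :
    psi α β x t = PsiP α β α := by
  rw [psi_of_pos ht]
  exact PsiP_of_le ((div_le_iff₀ (Real.sqrt_pos.2 ht)).2 h)

lemma ustarZero_eq (α β : ℝ) : ustarZero α β = PsiP α β α * erf (α / 2) := by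
  rw [ustarZero, PsiP_eq, max_self]
  ring

lemma ustarZero_nonneg {α β : ℝ} (hα : 0 < α) (hβ : 0 < β) : 0 ≤ ustarZero α β := by
  rw [ustarZero_eq]
  exact mul_nonneg (PsiP_nonneg hα hβ _) (erf_nonneg (by positivity))

lemma PhiZero_eq {α : ℝ} (hα : 0 < α) (β η : ℝ) :
    PhiZero α β η = PsiP α β η - PsiP α β α * erfc (η / 2) := by
  have h1 : erf (α / 2) ≠ 0 := (erf_pos (by positivity)).ne'
  have h2 : erfc (α / 2) ≠ 0 := (erfc_pos _).ne'
  rw [PhiZero]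
  split_ifs with h
  · rw [PsiP_of_le h.le, ustarZero_eq, erfc_eq_one_sub (η / 2)]
    field_simp
    ring
  · rw [ustarZero_eq, PsiP_eq, PsiP_eq, max_self, max_eq_left (not_lt.1 h)]
    have h3 : erf (α / 2) = 1 - erfc (α / 2) := by linarith [erf_add_erfc (α / 2)]
    rw [h3]
    field_simp

lemma PhiZero_nonneg {α β η : ℝ} (hα : 0 < α) (hβ : 0 < β) (hη : 0 ≤ η) :
    0 ≤ PhiZero α β η := by
  have h0 := ustarZero_nonneg hα hβ
  rw [PhiZero]
  split_ifs with h
  · exact div_nonneg (mul_nonneg h0 (erf_nonneg (by positivity))) (erf_nonneg (by positivity))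
  · exact div_nonneg (mul_nonneg h0 (erfc_nonneg _)) (erfc_nonneg _)

lemma PhiZero_le {α β η : ℝ} (hα : 0 < α) (hβ : 0 < β) : PhiZero α β η ≤ ustarZero α β := by
  have h0 := ustarZero_nonneg hα hβ
  rw [PhiZero]
  split_ifs with h
  · rw [div_le_iff₀ (erf_pos (by positivity))]
    refine mul_le_mul_of_nonneg_left ?_ h0
    linarith [erf_add_erfc (η / 2), erf_add_erfc (α / 2),
      erfc_strictAnti.antitone (show η / 2 ≤ α / 2 by linarith)]
  · rw [div_le_iff₀ (erfc_pos _)]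
    refine mul_le_mul_of_nonneg_left (erfc_strictAnti.antitone ?_) h0
    linarith

lemma measurable_psi (α β : ℝ) : Measurable fun q : ℝ × ℝ => psi α β q.1 q.2 := by
  have h : (fun q : ℝ × ℝ => psi α β q.1 q.2) = fun q : ℝ × ℝ => if 0 < q.2 then
      α * β / 2 * Real.exp (α ^ 2 / 4) *
        (Real.sqrt Real.pi * erfc (max (|q.1| / Real.sqrt q.2) α / 2)) else 0 := by
    funext q
    rw [psi, integral_Ioi_exp_neg_sq_div_four]
  rw [h]
  have := continuous_erfc.measurable
  exact Measurable.ite (measurableSet_lt measurable_const measurable_snd) (by fun_prop)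
    measurable_const

end Profiles

section Barriers

open Function

/-- The heat kernel up to normalization. -/
def heatG (x s : ℝ) : ℝ := (Real.sqrt s)⁻¹ * Real.exp (-x ^ 2 / (4 * s))

/-- The self-similar solution of the heat equation with step initial datum. -/
def heatE (x s : ℝ) : ℝ := erfc (x / (2 * Real.sqrt s))

lemma heatG_pos {x s : ℝ} (hs : 0 < s) : 0 < heatG x s :=
  mul_pos (inv_pos.2 (Real.sqrt_pos.2 hs)) (Real.exp_pos _)

lemma exp_heatE {x s : ℝ} (hs : 0 < s) :
    Real.exp (-(x / (2 * Real.sqrt s)) ^ 2) = Real.exp (-x ^ 2 / (4 * s)) := by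
  congr 1
  rw [div_pow, mul_pow, Real.sq_sqrt hs.le]
  ring

lemma hasDerivAt_heatE_left (x : ℝ) {s : ℝ} (hs : 0 < s) :
    HasDerivAt (fun y => heatE y s) (-(1 / Real.sqrt Real.pi * heatG x s)) x := by
  have h := (hasDerivAt_erfc (x / (2 * Real.sqrt s))).comp x
    ((hasDerivAt_id x).div_const (2 * Real.sqrt s))
  rw [exp_heatE hs] at h
  refine h.congr_deriv ?_
  have : 0 < Real.sqrt s := Real.sqrt_pos.2 hs
  rw [heatG]
  field_simp

lemma hasDerivAt_inv_sqrt {s : ℝ} (hs : 0 < s) :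
    HasDerivAt (fun r => (Real.sqrt r)⁻¹) (-(1 / (2 * s)) * (Real.sqrt s)⁻¹) s := by
  have h := (Real.hasDerivAt_sqrt hs.ne').inv (Real.sqrt_pos.2 hs).ne'
  refine h.congr_deriv ?_
  have : 0 < Real.sqrt s := Real.sqrt_pos.2 hs
  rw [Real.sq_sqrt hs.le]
  field_simp

lemma hasDerivAt_heatE_right (x : ℝ) {s : ℝ} (hs : 0 < s) :
    HasDerivAt (heatE x) (1 / Real.sqrt Real.pi * (x / (2 * s)) * heatG x s) s := by
  have h1 : HasDerivAt (fun r => x / (2 * Real.sqrt r))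
      (x / 2 * (-(1 / (2 * s)) * (Real.sqrt s)⁻¹)) s := by
    refine ((hasDerivAt_inv_sqrt hs).const_mul (x / 2)).congr_of_eventuallyEq ?_
    exact Eventually.of_forall fun r => by simp only [div_eq_mul_inv, mul_inv]; ring
  have h := (hasDerivAt_erfc (x / (2 * Real.sqrt s))).comp s h1
  rw [exp_heatE hs] at h
  refine h.congr_deriv ?_
  rw [heatG]
  have : 0 < Real.sqrt s := Real.sqrt_pos.2 hs
  field_simp

lemma hasDerivAt_heatG_left (x : ℝ) {s : ℝ} (hs : 0 < s) :
    HasDerivAt (fun y => heatG y s) (-(x / (2 * s)) * heatG x s) x := by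
  have h1 : HasDerivAt (fun y : ℝ => -y ^ 2 / (4 * s)) (-(x / (2 * s))) x := by
    have := (((hasDerivAt_id x).pow 2).neg).div_const (4 * s)
    refine this.congr_deriv ?_
    simp only [id]
    field_simp
    norm_num
    ring
  refine (h1.exp.const_mul (Real.sqrt s)⁻¹).congr_deriv ?_
  rw [heatG]
  ring

lemma hasDerivAt_heatG_right (x : ℝ) {s : ℝ} (hs : 0 < s) :
    HasDerivAt (heatG x) ((-(1 / (2 * s)) + x ^ 2 / (4 * s ^ 2)) * heatG x s) s := by
  have h1 : HasDerivAt (fun r : ℝ => -x ^ 2 / (4 * r)) (x ^ 2 / (4 * s ^ 2)) s := by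
    have := ((hasDerivAt_id s).inv hs.ne').const_mul (-x ^ 2 / 4)
    refine (this.congr_deriv ?_).congr_of_eventuallyEq ?_
    · simp only [id]
      field_simp
    · exact Eventually.of_forall fun r => by simp [div_eq_mul_inv]; ring
  refine ((hasDerivAt_inv_sqrt hs).mul h1.exp).congr_deriv ?_
  rw [heatG]
  ring

lemma continuous_heatG_comp {τ : ℝ → ℝ} (hτ : Continuous τ) (hτ0 : ∀ t, 0 < τ t) :
    Continuous fun q : ℝ × ℝ => heatG q.1 (τ q.2) := by
  have h1 : ∀ q : ℝ × ℝ, Real.sqrt (τ q.2) ≠ 0 := fun q => (Real.sqrt_pos.2 (hτ0 _)).ne'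
  have h2 : ∀ q : ℝ × ℝ, 4 * τ q.2 ≠ 0 := fun q => (mul_pos four_pos (hτ0 _)).ne'
  unfold heatG
  fun_prop (disch := assumption)

lemma continuous_heatE_comp {τ : ℝ → ℝ} (hτ : Continuous τ) (hτ0 : ∀ t, 0 < τ t) :
    Continuous fun q : ℝ × ℝ => heatE q.1 (τ q.2) := by
  have h1 : ∀ q : ℝ × ℝ, 2 * Real.sqrt (τ q.2) ≠ 0 := fun q =>
    (mul_pos two_pos (Real.sqrt_pos.2 (hτ0 _))).ne'
  have := continuous_erfc
  unfold heatE
  fun_prop (disch := assumption)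

/-- A regular function obeying the balance law `V_t = W_x - F` with `W = V_x`, with homogeneous
Neumann condition at the origin. -/
structure IsBalanced (V W F : ℝ → ℝ → ℝ) : Prop where
  continuous_left : Continuous (uncurry V)
  continuous_right : Continuous (uncurry W)
  hasDerivAt : ∀ x t, HasDerivAt (fun y => V y t) (W x t) x
  measurable : Measurable (uncurry F)
  bound : ∀ T, ∃ C, ∀ x t, t ≤ T → |F x t| ≤ C
  bound_left : ∀ T, ∃ C, ∀ x t, t ≤ T → |V x t| ≤ C
  neumann : ∀ t, W 0 t = 0
  balance : ∀ t t', 0 ≤ t → t ≤ t' → ∀ a b, (∫ s in t..t', W b s) - ∫ s in t..t', W a s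
      = ∫ x in a..b, (V x t' - V x t + ∫ s in t..t', F x s)

lemma IsBalanced.neg {V W F : ℝ → ℝ → ℝ} (h : IsBalanced V W F) :
    IsBalanced (fun x t => -V x t) (fun x t => -W x t) (fun x t => -F x t) where
  continuous_left := h.continuous_left.neg
  continuous_right := h.continuous_right.neg
  hasDerivAt x t := (h.hasDerivAt x t).neg
  measurable := h.measurable.neg
  bound T := by simpa only [abs_neg] using h.bound T
  bound_left T := by simpa only [abs_neg] using h.bound_left T
  neumann t := by simp [h.neumann t]
  balance t t' ht htt' a b := by
    have e : (fun x => -V x t' - -V x t + ∫ s in t..t', -F x s)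
        = fun x => -(V x t' - V x t + ∫ s in t..t', F x s) := by
      funext x
      rw [intervalIntegral.integral_neg]
      ring
    rw [e, intervalIntegral.integral_neg, intervalIntegral.integral_neg,
      intervalIntegral.integral_neg, ← h.balance t t' ht htt' a b]
    ring

/-- Comparison with barriers of the form `a E + K g G`. -/
lemma IsBalanced.le_barrier {V W F : ℝ → ℝ → ℝ} (h : IsBalanced V W F)
    {g g₁ g₂ : ℝ → ℝ} (hg : ∀ x, HasDerivAt g (g₁ x) x) (hg₁ : ∀ x, HasDerivAt g₁ (g₂ x) x)
    (hg₂ : Continuous g₂) (hg0 : ∀ x, 0 ≤ g x) {a K t₁ σ : ℝ} (hK : 0 ≤ K) (ht₁ : 0 ≤ t₁)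
    (hσ : 0 < t₁ + σ) (h0 : K * g₁ 0 ≤ a / Real.sqrt Real.pi)
    (hinit : ∀ x, 0 ≤ x → V x t₁ ≤ a * heatE x (t₁ + σ) + K * (heatG x (t₁ + σ) * g x))
    (hsuper : ∀ x t, 0 ≤ x → t₁ ≤ t →
      a * heatE x (t + σ) + K * (heatG x (t + σ) * g x) < V x t →
      K * (heatG x (t + σ) * (g₂ x - x / (t + σ) * g₁ x)) ≤ F x t)
    {x t : ℝ} (hx : 0 ≤ x) (ht : t₁ ≤ t) :
    V x t ≤ a * heatE x (t + σ) + K * (heatG x (t + σ) * g x) := by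
  set τ : ℝ → ℝ := fun t => max t t₁ + σ with hτdef
  have hτc : Continuous τ := by fun_prop
  have hτ0 : ∀ t, 0 < τ t := fun t => hσ.trans_le (by simp [hτdef])
  have hτt : ∀ t, t₁ ≤ t → τ t = t + σ := fun t ht => by simp [hτdef, ht]
  have cG : Continuous fun q : ℝ × ℝ => heatG q.1 (τ q.2) := continuous_heatG_comp hτc hτ0
  have cE : Continuous fun q : ℝ × ℝ => heatE q.1 (τ q.2) := continuous_heatE_comp hτc hτ0
  have cg : Continuous g := continuous_iff_continuousAt.2 fun x => (hg x).continuousAt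
  have cg₁ : Continuous g₁ := continuous_iff_continuousAt.2 fun x => (hg₁ x).continuousAt
  have d2 : ∀ q : ℝ × ℝ, 2 * τ q.2 ≠ 0 := fun q => (mul_pos two_pos (hτ0 _)).ne'
  have d4 : ∀ q : ℝ × ℝ, 4 * τ q.2 ^ 2 ≠ 0 := fun q =>
    (mul_pos four_pos (pow_pos (hτ0 _) 2)).ne'
  have key := le_of_supersolution h.continuous_left h.continuous_right h.hasDerivAt h.measurable
    h.bound h.bound_left h.neumann h.balance
    (B := fun x t => a * heatE x (τ t) + K * (heatG x (τ t) * g x))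
    (Bx := fun x t => a * (-(1 / Real.sqrt Real.pi * heatG x (τ t)))
      + K * (-(x / (2 * τ t)) * heatG x (τ t) * g x + heatG x (τ t) * g₁ x))
    (Bxx := fun x t => a * (1 / Real.sqrt Real.pi * (x / (2 * τ t)) * heatG x (τ t))
      + K * ((-(1 / (2 * τ t)) + x ^ 2 / (4 * τ t ^ 2)) * heatG x (τ t) * g x
        + 2 * (-(x / (2 * τ t)) * heatG x (τ t) * g₁ x) + heatG x (τ t) * g₂ x))
    (Bt := fun x t => a * (1 / Real.sqrt Real.pi * (x / (2 * τ t)) * heatG x (τ t))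
      + K * ((-(1 / (2 * τ t)) + x ^ 2 / (4 * τ t ^ 2)) * heatG x (τ t) * g x))
    (t₁ := t₁) (C := -|a|) ht₁ ?_ ?_ ?_ ?_ ?_ ?_ ?_ ?_ ?_ ?_ ?_ hx ht
  · simpa only [hτt t ht] using key
  · simp only [uncurry_def]
    fun_prop
  · simp only [uncurry_def]
    fun_prop (disch := assumption)
  · simp only [uncurry_def]
    fun_prop (disch := assumption)
  · simp only [uncurry_def]
    fun_prop (disch := assumption)
  · intro x t
    exact ((hasDerivAt_heatE_left x (hτ0 t)).const_mul a).add
      (((hasDerivAt_heatG_left x (hτ0 t)).mul (hg x)).const_mul K)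
  · intro x t
    have hG := hasDerivAt_heatG_left x (hτ0 t)
    have hl : HasDerivAt (fun y : ℝ => -(y / (2 * τ t))) (-(1 / (2 * τ t))) x :=
      ((hasDerivAt_id x).div_const _).neg
    refine (((hG.const_mul (1 / Real.sqrt Real.pi)).neg.const_mul a).add
      ((((hl.mul hG).mul (hg x)).add (hG.mul (hg₁ x))).const_mul K)).congr_deriv ?_
    have := (hτ0 t).ne'
    have hpi : Real.sqrt Real.pi ≠ 0 := (Real.sqrt_pos.2 Real.pi_pos).ne'
    simp only [Pi.mul_apply]
    field_simp
    ring
  · intro x t ht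
    have hev : ∀ᶠ r in nhds t, τ r = r + σ := by
      filter_upwards [Ioi_mem_nhds ht] with r hr using hτt r (le_of_lt hr)
    have h1 : HasDerivAt τ 1 t :=
      ((hasDerivAt_id t).add_const σ).congr_of_eventuallyEq hev
    have hE := (hasDerivAt_heatE_right x (hτ0 t)).comp t h1
    have hG := (hasDerivAt_heatG_right x (hτ0 t)).comp t h1
    rw [mul_one] at hE hG
    exact (hE.const_mul a).add ((hG.mul_const (g x)).const_mul K)
  · intro x t hx
    have hE0 : 0 ≤ heatE x (τ t) := erfc_nonneg _
    have hE1 : heatE x (τ t) ≤ 1 := erfc_le_one (by positivity)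
    have h1 : 0 ≤ K * (heatG x (τ t) * g x) :=
      mul_nonneg hK (mul_nonneg (heatG_pos (hτ0 t)).le (hg0 x))
    have h2 : |a * heatE x (τ t)| ≤ |a| := by
      rw [abs_mul, abs_of_nonneg hE0]
      exact mul_le_of_le_one_right (abs_nonneg a) hE1
    linarith [neg_abs_le (a * heatE x (τ t))]
  · intro t _
    have := mul_nonneg (sub_nonneg.2 h0) (heatG_pos (x := 0) (hτ0 t)).le
    rw [zero_div, neg_zero, zero_mul, zero_mul, zero_add]
    rw [sub_mul] at this
    have e : a / Real.sqrt Real.pi * heatG 0 (τ t)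
        = a * (1 / Real.sqrt Real.pi * heatG 0 (τ t)) := by ring
    linarith
  · intro x hx
    simpa only [hτt t₁ le_rfl] using hinit x hx
  · intro x t hx ht hlt
    simp only [hτt t ht] at hlt ⊢
    refine le_trans (le_of_eq ?_) (hsuper x t hx ht hlt)
    have : t + σ ≠ 0 := by linarith
    field_simp
    ring

end Barriers

section WeakSolution

open Function

variable {α β ustar : ℝ} {u p : ℝ → ℝ → ℝ}

lemma IsWeakSolution.precipitation_mem (h : IsWeakSolution α β ustar u p) (x : ℝ) {t : ℝ}
    (ht : 0 ≤ t) : p x t ∈ Icc (0:ℝ) 1 := by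
  obtain ⟨-, -, -, hp, -⟩ := h
  obtain ⟨h1, h2, h3⟩ := hp x t ht
  rcases lt_trichotomy (sSup ((fun s => u x s) '' Icc 0 t)) ustar with hc | hc | hc
  · rw [h1 hc]; exact ⟨le_rfl, zero_le_one⟩
  · exact h2 hc
  · rw [h3 hc]; exact ⟨zero_le_one, le_rfl⟩

lemma IsWeakSolution.isBalanced (h : IsWeakSolution α β ustar u p) (hα : 0 < α) (hβ : 0 < β) :
    (∃ W, IsBalanced (fun x t => u x (max t 0) - psi α β x (max t 0)) W
      (fun x t => p x (max t 0) * u x (max t 0))) ∧ ∀ x, u x 0 = 0 := by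
  have hp01 := h.precipitation_mem
  obtain ⟨hu, -, hpm, -, -, w, ⟨hd, hVc, hwc, hb⟩, hweak⟩ := h
  set V : ℝ → ℝ → ℝ := fun x t => u x (max t 0) - psi α β x (max t 0) with hVdef
  set W : ℝ → ℝ → ℝ := fun x t => w x (max t 0) with hWdef
  set F : ℝ → ℝ → ℝ := fun x t => p x (max t 0) * u x (max t 0) with hFdef
  have hproj : Continuous fun q : ℝ × ℝ => (q.1, max q.2 0) := by fun_prop
  have hmem : ∀ q : ℝ × ℝ, (q.1, max q.2 0) ∈ (univ : Set ℝ) ×ˢ Ici (0:ℝ) := fun q =>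
    ⟨trivial, show (0:ℝ) ≤ max q.2 0 from le_max_right _ _⟩
  have hV : Continuous (uncurry V) := hVc.comp_continuous hproj hmem
  have hW : Continuous (uncurry W) := hwc.comp_continuous hproj hmem
  have hmax : ∀ t : ℝ, 0 ≤ max t 0 := fun t => le_max_right _ _
  have hbd : ∀ T, ∃ C, ∀ x t, t ≤ T → |V x t| ≤ C := by
    intro T
    obtain ⟨C, hC⟩ := hb (max T 1) (by positivity)
    exact ⟨C, fun x t ht => (hC x (max t 0) ⟨hmax t,
      max_le_max ht zero_le_one⟩).1⟩
  have hpsi : Measurable fun q : ℝ × ℝ => psi α β q.1 (max q.2 0) :=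
    (measurable_psi α β).comp hproj.measurable
  have hF : Measurable (uncurry F) := by
    have h1 : uncurry F = fun q : ℝ × ℝ =>
        p q.1 (max q.2 0) * (uncurry V q + psi α β q.1 (max q.2 0)) := by
      funext q
      simp only [uncurry_def, hVdef, hFdef, sub_add_cancel]
    rw [h1]
    exact (hpm.comp hproj.measurable).mul (hV.measurable.add hpsi)
  have hFb : ∀ T, ∃ C, ∀ x t, t ≤ T → |F x t| ≤ C := by
    intro T
    obtain ⟨C, hC⟩ := hbd T
    refine ⟨C + PsiP α β α, fun x t ht => ?_⟩
    have h1 := hp01 x (hmax t)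
    have h2 : u x (max t 0) = V x t + psi α β x (max t 0) := by simp [hVdef]
    simp only [hFdef]
    rw [abs_mul, abs_of_nonneg h1.1]
    refine (mul_le_of_le_one_left (abs_nonneg _) h1.2).trans ?_
    rw [h2]
    refine (abs_add_le _ _).trans (add_le_add (hC x t ht) ?_)
    rw [abs_of_nonneg (psi_nonneg hα hβ (hmax t))]
    exact psi_le hα hβ (hmax t)
  have hWE : WeakEq V W F := by
    intro T hT φ φt φx hφ
    have h1 := hweak T hT φ φt φx hφ
    have h2 : ∀ t ∈ Ioc (0:ℝ) T, max t 0 = t := fun t ht => max_eq_left ht.1.le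
    refine ((setIntegral_congr_fun measurableSet_Ioc fun t ht => ?_).trans h1).trans
      (setIntegral_congr_fun measurableSet_Ioc fun t ht => ?_)
    · simp only [hVdef, h2 t ht]
    · simp only [hWdef, hFdef, h2 t ht]
  refine ⟨⟨W, hV, hW, fun x t => hd (max t 0) (hmax t) x, hF, hFb, hbd, fun t => ?_,
    fun t t' ht htt' a b => hWE.balance hV hW hF hFb ht htt' a b⟩, fun x => ?_⟩
  · have h1 := hd (max t 0) (hmax t) 0
    have h2 : HasDerivAt (fun y => u y (max t 0) - psi α β y (max t 0)) (-w 0 (max t 0)) 0 := by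
      have h3 : HasDerivAt (fun y => u y (max t 0) - psi α β y (max t 0)) (w 0 (max t 0))
        (-(0:ℝ)) := by rwa [neg_zero]
      have h4 := h3.comp (0:ℝ) (hasDerivAt_neg (0:ℝ))
      rw [mul_neg_one] at h4
      refine h4.congr_of_eventuallyEq (Eventually.of_forall fun y => ?_)
      simp [hu, psi_neg_left]
    have := h1.unique h2
    simp only [hWdef]
    linarith
  · have := hWE.initial_eq_zero hV hW hF hFb x
    simpa [hVdef, psi_zero_right] using this

/-- The concentration never exceeds the precipitation-free solution. -/
lemma IsWeakSolution.le_psi (h : IsWeakSolution α β ustar u p) (hα : 0 < α) (hβ : 0 < β)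
    (x : ℝ) {t : ℝ} (ht : 0 ≤ t) : u x t ≤ psi α β x t := by
  obtain ⟨⟨W, hW⟩, hu0⟩ := h.isBalanced hα hβ
  have key := fun y hy => hW.le_barrier (g := fun _ => 0) (g₁ := fun _ => 0) (g₂ := fun _ => 0)
    (fun x => hasDerivAt_const x 0) (fun x => hasDerivAt_const x 0) continuous_const
    (fun _ => le_rfl) (a := 0) (K := 0) (t₁ := 0) (σ := 1) le_rfl le_rfl (by norm_num) (by simp)
    (fun x _ => by simp [hu0, psi_zero_right]) (fun x t _ ht' hlt => by
      simp only [max_eq_left ht', zero_mul, add_zero, mul_zero, sub_zero] at hlt ⊢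
      refine mul_nonneg (h.precipitation_mem x ht').1 ?_
      linarith [psi_nonneg hα hβ (x := x) ht']) (x := y) hy ht
  have key' : ∀ y, 0 ≤ y → u y t ≤ psi α β y t := fun y hy => by
    have := key y hy
    simp only [max_eq_left ht, zero_mul, add_zero] at this
    linarith
  rcases le_total 0 x with hx | hx
  · exact key' x hx
  · have := key' (-x) (by linarith)
    rwa [h.1, psi_neg_left] at this

lemma IsWeakSolution.bddAbove (h : IsWeakSolution α β ustar u p) (hα : 0 < α) (hβ : 0 < β)
    (x t : ℝ) : BddAbove ((fun s => u x s) '' Icc 0 t) := by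
  refine ⟨PsiP α β α, ?_⟩
  rintro _ ⟨s, hs, rfl⟩
  exact (h.le_psi hα hβ x hs.1).trans (psi_le hα hβ hs.1)

/-- Precipitation occurs in a neighborhood of the origin. -/
lemma IsWeakSolution.exists_precipitation_eq_one (h : IsWeakSolution α β ustar u p)
    (hα : 0 < α) (hβ : 0 < β) (hu : ustar < PsiP α β α) :
    ∃ δ > 0, ∃ t₀ > 0, ∀ x t, |x| ≤ δ → t₀ ≤ t → p x t = 1 := by
  obtain ⟨⟨W, hW⟩, hu0⟩ := h.isBalanced hα hβ
  obtain ⟨r, hr, hrV⟩ := Metric.continuous_iff.1 hW.continuous_left (0, 0)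
    (PsiP α β α - ustar) (by linarith)
  have ht₀ : 0 < r / 2 := by positivity
  refine ⟨min (r / 2) (α * Real.sqrt (r / 2)), by positivity, r / 2, ht₀, fun x t hx ht => ?_⟩
  have h1 := hrV (x, r / 2) (by
    rw [Prod.dist_eq, max_lt_iff]
    simp only [Real.dist_eq, sub_zero]
    constructor
    · linarith [hx.trans (min_le_left _ _)]
    · rw [abs_of_pos ht₀]; linarith)
  simp only [uncurry_def, max_eq_left ht₀.le, max_self, hu0, psi_zero_right, Real.dist_eq,
    sub_zero, psi_of_le ht₀ (hx.trans (min_le_right _ _))] at h1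
  have h2 : ustar < u x (r / 2) := by linarith [(abs_lt.1 h1).1]
  obtain ⟨-, -, -, hp, -⟩ := id h
  exact (hp x t (ht₀.le.trans ht)).2.2 (h2.trans_le
    (le_csSup (h.bddAbove hα hβ x t) ⟨r / 2, ⟨ht₀.le, ht⟩, rfl⟩))

end WeakSolution

section LongTime

variable {α β ustar : ℝ} {u p : ℝ → ℝ → ℝ}

lemma hasDerivAt_max_zero_pow (n : ℕ) (y : ℝ) :
    HasDerivAt (fun x : ℝ => max x 0 ^ (n + 2)) ((n + 2) * max y 0 ^ (n + 1)) y := by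
  rcases lt_trichotomy y 0 with h | rfl | h
  · rw [max_eq_right h.le, zero_pow n.succ_ne_zero, mul_zero]
    refine (hasDerivAt_const y (0:ℝ)).congr_of_eventuallyEq ?_
    filter_upwards [Iio_mem_nhds h] with x hx
    rw [max_eq_right (le_of_lt hx), zero_pow (by omega)]
  · rw [max_self, zero_pow n.succ_ne_zero, mul_zero]
    have h1 : (fun x : ℝ => max x 0 ^ (n + 2)) =O[nhds 0] fun x => ‖x - 0‖ ^ (n + 2) := by
      refine Asymptotics.IsBigO.of_bound 1 (Eventually.of_forall fun x => ?_)
      rw [one_mul, sub_zero, norm_pow, norm_pow, norm_norm]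
      refine pow_le_pow_left₀ (norm_nonneg _) ?_ _
      rw [Real.norm_eq_abs, Real.norm_eq_abs, abs_of_nonneg (le_max_right _ _)]
      exact max_le (le_abs_self x) (abs_nonneg x)
    simpa using (h1.hasFDerivAt (by omega)).hasDerivAt
  · rw [max_eq_left h.le]
    have h1 := hasDerivAt_pow (n + 2) y
    push_cast at h1
    refine h1.congr_of_eventuallyEq ?_
    filter_upwards [Ioi_mem_nhds h] with x hx
    rw [max_eq_left (le_of_lt hx)]

lemma heatE_eq (x s : ℝ) : heatE x s = erfc (x / Real.sqrt s / 2) := by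
  rw [heatE, div_div, mul_comm]

lemma heatG_le {x s : ℝ} (hs : 0 < s) : heatG x s ≤ 1 / Real.sqrt s := by
  rw [heatG, one_div]
  refine mul_le_of_le_one_right (by positivity) (Real.exp_le_one_iff.2 ?_)
  exact div_nonpos_of_nonpos_of_nonneg (by nlinarith [sq_nonneg x]) (by positivity)

lemma heatE_le {x s : ℝ} (hx : 0 ≤ x) (hs : 0 < s) : heatE x s ≤ Real.sqrt s * heatG x s := by
  have h := erfc_le_exp (show 0 ≤ x / (2 * Real.sqrt s) by positivity)
  rw [exp_heatE hs] at h
  rwa [heatG, mul_inv_cancel_left₀ (Real.sqrt_pos.2 hs).ne']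

lemma psi_sub_eq_PhiZero (hα : 0 < α) {x t : ℝ} (hx : 0 ≤ x) (ht : 0 < t) :
    psi α β x t - PsiP α β α * heatE x t = PhiZero α β (x / Real.sqrt t) := by
  rw [PhiZero_eq hα, heatE_eq, psi_of_pos ht, abs_of_nonneg hx]

/-- The concentration is asymptotically bounded above by the critical profile. -/
lemma IsWeakSolution.exists_upper_bound (h : IsWeakSolution α β ustar u p)
    (hα : 0 < α) (hβ : 0 < β) (hu : ustar < PsiP α β α) :
    ∃ C ≥ 0, ∃ T > 0, ∀ x t, 0 ≤ x → T ≤ t →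
      u x t ≤ PhiZero α β (x / Real.sqrt t) + C / Real.sqrt t := by
  obtain ⟨⟨W, hW⟩, -⟩ := h.isBalanced hα hβ
  obtain ⟨δ, hδ, t₀, ht₀, hp1⟩ := h.exists_precipitation_eq_one hα hβ hu
  have hP0 : 0 ≤ PsiP α β α := PsiP_nonneg hα hβ _
  have hpi : 0 < Real.sqrt Real.pi := Real.sqrt_pos.2 Real.pi_pos
  set P := PsiP α β α with hPdef
  obtain ⟨t₁, ht₁0, htt₁, hδt₁, hαt₁⟩ : ∃ t₁ : ℝ, 0 < t₁ ∧ t₀ ≤ t₁ ∧ δ ^ 2 ≤ t₁ ∧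
      (δ / α) ^ 2 ≤ t₁ :=
    ⟨t₀ + δ ^ 2 + (δ / α) ^ 2, by positivity, by nlinarith [sq_nonneg δ, sq_nonneg (δ / α)],
      by nlinarith [sq_nonneg δ, sq_nonneg (δ / α)], by nlinarith [sq_nonneg δ]⟩
  set K := 4 * P / (δ * Real.sqrt Real.pi) + P * Real.sqrt t₁ with hKdef
  have hK1 : 0 ≤ 4 * P / (δ * Real.sqrt Real.pi) := by positivity
  have hK2 : 0 ≤ P * Real.sqrt t₁ := by positivity
  have hK : 0 ≤ K := by positivity
  have hd : ∀ x : ℝ, HasDerivAt (fun y => δ - y) (-1) x := fun x =>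
    (hasDerivAt_id x).const_sub δ
  set g : ℝ → ℝ := fun x => 1 + max (δ - x) 0 ^ 3 / (12 * δ) with hgdef
  have hg1 : ∀ x, 1 ≤ g x := fun x => by
    have : 0 ≤ max (δ - x) 0 := le_max_right _ _
    simp only [hgdef, le_add_iff_nonneg_right]
    positivity
  have key := fun x t hx ht => hW.le_barrier (g := g)
    (g₁ := fun x => -(max (δ - x) 0 ^ 2 / (4 * δ))) (g₂ := fun x => max (δ - x) 0 / (2 * δ))
    (fun x => by
      have h1 := (((hasDerivAt_max_zero_pow 1 (δ - x)).comp x (hd x)).div_const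
        (12 * δ)).const_add 1
      refine h1.congr_deriv ?_
      push_cast
      field_simp
      norm_num
      ring)
    (fun x => by
      have h1 := (((hasDerivAt_max_zero_pow 0 (δ - x)).comp x (hd x)).div_const (4 * δ)).neg
      refine h1.congr_deriv ?_
      push_cast
      field_simp
      norm_num
      ring)
    (by fun_prop) (fun x => zero_le_one.trans (hg1 x)) (a := -P) (K := K) (t₁ := t₁) (σ := 0)
    hK ht₁0.le (by simpa using ht₁0) ?_ ?_ ?_ (x := x) (t := t) hx ht
  · refine ⟨K * (1 + δ ^ 2 / 12), by positivity, t₁, ht₁0, fun x t hx ht => ?_⟩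
    have ht0 : 0 < t := ht₁0.trans_le ht
    have h1 := key x t hx ht
    rw [add_zero, max_eq_left ht0.le] at h1
    have h2 : g x ≤ 1 + δ ^ 2 / 12 := by
      have h3 : max (δ - x) 0 ≤ δ := max_le (by linarith) hδ.le
      have h4 : max (δ - x) 0 ^ 3 ≤ δ ^ 3 := pow_le_pow_left₀ (le_max_right _ _) h3 3
      have h5 : max (δ - x) 0 ^ 3 / (12 * δ) ≤ δ ^ 3 / (12 * δ) := by gcongr
      have h6 : δ ^ 3 / (12 * δ) = δ ^ 2 / 12 := by field_simp
      simp only [hgdef]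
      linarith
    have h3 : K * (heatG x t * g x) ≤ K * (1 / Real.sqrt t * (1 + δ ^ 2 / 12)) :=
      mul_le_mul_of_nonneg_left (mul_le_mul (heatG_le ht0) h2 (zero_le_one.trans (hg1 x))
        (by positivity)) hK
    rw [← psi_sub_eq_PhiZero hα hx ht0]
    have h4 : K * (1 + δ ^ 2 / 12) / Real.sqrt t
        = K * (1 / Real.sqrt t * (1 + δ ^ 2 / 12)) := by ring
    linarith
  · have h1 : 4 * P / (δ * Real.sqrt Real.pi) * (δ / 4) = P / Real.sqrt Real.pi := by field_simp
    have h2 : max (δ - 0) 0 ^ 2 / (4 * δ) = δ / 4 := by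
      rw [sub_zero, max_eq_left hδ.le]
      field_simp
    rw [h2, hKdef, neg_div, mul_neg, neg_le_neg_iff, ← h1]
    exact mul_le_mul_of_nonneg_right (by linarith) (by positivity)
  · intro x hx
    rw [add_zero, max_eq_left ht₁0.le]
    have h1 := h.le_psi hα hβ x ht₁0.le
    have hG := heatG_pos (x := x) ht₁0
    have h2 : P * heatE x t₁ ≤ P * (Real.sqrt t₁ * heatG x t₁) :=
      mul_le_mul_of_nonneg_left (heatE_le hx ht₁0) hP0
    have h3 : P * Real.sqrt t₁ * heatG x t₁ ≤ K * (heatG x t₁ * g x) := by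
      rw [mul_left_comm K, mul_comm _ (heatG x t₁)]
      refine mul_le_mul_of_nonneg_left ?_ hG.le
      nlinarith [mul_nonneg hK (sub_nonneg.2 (hg1 x))]
    linarith
  · intro x t hx ht hlt
    have ht0 : 0 < t := ht₁0.trans_le ht
    rw [add_zero] at hlt ⊢
    rw [max_eq_left ht0.le] at hlt ⊢
    have hG := heatG_pos (x := x) ht0
    have hE : heatE x t ≤ 1 := erfc_le_one (by positivity)
    have hKG : 0 ≤ K * (heatG x t * g x) :=
      mul_nonneg hK (mul_nonneg hG.le (zero_le_one.trans (hg1 x)))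
    rcases le_or_gt x δ with hxδ | hxδ
    · have h1 : psi α β x t = P := by
        refine psi_of_le ht0 ?_
        rw [abs_of_nonneg hx, ← div_le_iff₀' hα]
        refine (div_le_div_of_nonneg_right hxδ hα.le).trans (Real.le_sqrt_of_sq_le ?_)
        linarith
      rw [hp1 x t (by rwa [abs_of_nonneg hx]) (htt₁.trans ht), one_mul, max_eq_left (by linarith)]
      have h2 : (δ - x) / (2 * δ) - x / t * -((δ - x) ^ 2 / (4 * δ)) ≤ g x := by
        refine le_trans ?_ (hg1 x)
        have h3 : (δ - x) / (2 * δ) ≤ 1 / 2 := by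
          rw [div_le_iff₀ (by positivity)]; linarith
        have h4 : (δ - x) ^ 2 / (4 * δ) ≤ δ / 4 := by
          rw [div_le_iff₀ (by positivity)]; nlinarith
        have h5 : x / t * ((δ - x) ^ 2 / (4 * δ)) ≤ δ / δ ^ 2 * (δ / 4) := by
          refine mul_le_mul ?_ h4 (by positivity) (by positivity)
          exact div_le_div₀ hδ.le hxδ (by positivity) (by linarith)
        have h6 : δ / δ ^ 2 * (δ / 4) = 1 / 4 := by field_simp
        linarith
      have h3 := mul_le_mul_of_nonneg_left (mul_le_mul_of_nonneg_left h2 hG.le) hK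
      nlinarith [mul_nonneg hP0 (sub_nonneg.2 hE)]
    · rw [max_eq_right (by linarith)]
      have h1 := psi_sub_eq_PhiZero (β := β) hα hx ht0
      have h2 := PhiZero_nonneg (η := x / Real.sqrt t) hα hβ (by positivity)
      have h3 : 0 ≤ p x t * u x t :=
        mul_nonneg (h.precipitation_mem x ht0.le).1 (by linarith)
      simpa using h3

/-- Precipitation is confined to a bounded region. -/
lemma IsWeakSolution.exists_precipitation_eq_zero (h : IsWeakSolution α β ustar u p)
    (hα : 0 < α) (hβ : 0 < β) (h₁ : ustarZero α β < ustar) (hu : ustar < PsiP α β α) :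
    ∃ X > 0, ∀ x t, 0 ≤ t → X ≤ |x| → p x t = 0 := by
  obtain ⟨C, hC, T, hT, hup⟩ := h.exists_upper_bound hα hβ hu
  have h0 := ustarZero_nonneg hα hβ
  have hε : 0 < (ustar - ustarZero α β) / 2 := by linarith
  obtain ⟨T₀, hT₀, hTT₀, hCT₀⟩ : ∃ T₀ : ℝ, 0 < T₀ ∧ T ≤ T₀ ∧
      C / Real.sqrt T₀ ≤ (ustar - ustarZero α β) / 2 := by
    refine ⟨max T ((C / ((ustar - ustarZero α β) / 2)) ^ 2), lt_max_of_lt_left hT,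
      le_max_left _ _, ?_⟩
    have hpos : 0 < Real.sqrt (max T ((C / ((ustar - ustarZero α β) / 2)) ^ 2)) :=
      Real.sqrt_pos.2 (lt_max_of_lt_left hT)
    rw [div_le_iff₀ hpos, ← div_le_iff₀' hε]
    exact Real.le_sqrt_of_sq_le (le_max_right _ _)
  have hs₀ : 0 < Real.sqrt T₀ := Real.sqrt_pos.2 hT₀
  obtain ⟨Y, hY, hY0⟩ := (((tendsto_PsiP_atTop α β).eventually_le_const
    (show 0 < ustar / 2 by linarith)).and (eventually_gt_atTop 0)).exists
  refine ⟨Y * Real.sqrt T₀, by positivity, ?_⟩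
  have hpos : ∀ x t, 0 ≤ t → Y * Real.sqrt T₀ ≤ x → p x t = 0 := by
    intro x t ht hx
    have hx0 : 0 ≤ x := le_trans (by positivity) hx
    obtain ⟨-, -, -, hp, -⟩ := id h
    refine (hp x t ht).1 (lt_of_le_of_lt (b := (ustarZero α β + ustar) / 2)
      (csSup_le ((nonempty_Icc.2 ht).image _) ?_) (by linarith))
    rintro _ ⟨s, hs, rfl⟩
    rcases le_total T₀ s with hsT | hsT
    · have hs0 : 0 < Real.sqrt s := Real.sqrt_pos.2 (hT₀.trans_le hsT)
      have e1 := hup x s hx0 (hTT₀.trans hsT)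
      have e2 := PhiZero_le (η := x / Real.sqrt s) hα hβ
      have e3 : C / Real.sqrt s ≤ C / Real.sqrt T₀ :=
        div_le_div_of_nonneg_left hC hs₀ (Real.sqrt_le_sqrt hsT)
      simp only
      linarith
    · refine (h.le_psi hα hβ x hs.1).trans ?_
      rcases hs.1.eq_or_lt with h4 | h4
      · rw [← h4, psi_zero_right]
        linarith
      · have hs0 : 0 < Real.sqrt s := Real.sqrt_pos.2 h4
        rw [psi_of_pos h4, abs_of_nonneg hx0]
        have e1 : Y ≤ x / Real.sqrt s := by
          rw [le_div_iff₀ hs0]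
          exact (mul_le_mul_of_nonneg_left (Real.sqrt_le_sqrt hsT) hY0.le).trans hx
        linarith [PsiP_antitone hα hβ e1]
  intro x t ht hx
  rcases le_total 0 x with h5 | h5
  · exact hpos x t ht (by rwa [abs_of_nonneg h5] at hx)
  · rw [← h.2.1 x t]
    exact hpos (-x) t ht (by rwa [abs_of_nonpos h5] at hx)

lemma erf_le {y : ℝ} (hy : 0 ≤ y) : erf y ≤ 2 / Real.sqrt Real.pi * y := by
  refine mul_le_mul_of_nonneg_left ?_ two_div_sqrt_pi_pos.le
  have hc : Continuous fun s : ℝ => Real.exp (-s ^ 2) := by fun_prop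
  have h := intervalIntegral.integral_mono_on hy (hc.intervalIntegrable (μ := volume) _ _)
    (continuous_const.intervalIntegrable (μ := volume) (u := fun _ => (1:ℝ)) _ _)
    fun s _ => Real.exp_le_one_iff.2 (neg_nonpos.2 (sq_nonneg s))
  simpa using h

/-- Bounded precipitation depletes the solution by a localized amount only. -/
lemma IsWeakSolution.exists_lower_bound (h : IsWeakSolution α β ustar u p)
    (hα : 0 < α) (hβ : 0 < β) {X : ℝ} (hX : 0 < X)
    (hp0 : ∀ x t, 0 ≤ t → X ≤ |x| → p x t = 0) :
    ∃ K ≥ 0, ∀ x t, 0 ≤ x → 0 ≤ t →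
      psi α β x t - PsiP α β α * heatE x (t + 1) - K / Real.sqrt (t + 1) ≤ u x t := by
  obtain ⟨⟨W, hW⟩, hu0⟩ := h.isBalanced hα hβ
  have hP0 : 0 ≤ PsiP α β α := PsiP_nonneg hα hβ _
  have hpi : 0 < Real.sqrt Real.pi := Real.sqrt_pos.2 Real.pi_pos
  set P := PsiP α β α with hPdef
  set K := P / Real.sqrt Real.pi * X * Real.exp (X ^ 2 / 4) with hKdef
  have hK : 0 ≤ K := by positivity
  refine ⟨K, hK, fun x t hx ht => ?_⟩
  have key := hW.neg.le_barrier (g := fun _ => 1) (g₁ := fun _ => 0) (g₂ := fun _ => 0)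
    (fun x => hasDerivAt_const x 1) (fun x => hasDerivAt_const x 0) continuous_const
    (fun _ => zero_le_one) (a := P) (K := K) (t₁ := 0) (σ := 1) hK le_rfl (by norm_num)
    (by rw [mul_zero]; positivity) ?_ ?_ hx ht
  · rw [max_eq_left ht, mul_one] at key
    have h1 := mul_le_mul_of_nonneg_left (heatG_le (x := x) (show 0 < t + 1 by linarith)) hK
    rw [mul_one_div] at h1
    linarith
  · intro x _
    have h1 := heatG_pos (x := x) (show (0:ℝ) < 0 + 1 by norm_num)
    have h2 : 0 ≤ heatE x (0 + 1) := erfc_nonneg _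
    rw [max_self, hu0, psi_zero_right, sub_zero, neg_zero, mul_one]
    positivity
  · intro x t hx ht hlt
    rw [max_eq_left ht] at hlt ⊢
    rw [mul_one] at hlt
    rw [mul_zero, sub_zero, mul_zero, mul_zero, neg_nonneg]
    rcases le_or_gt X x with hxX | hxX
    · rw [hp0 x t ht (hxX.trans (le_abs_self x)), zero_mul]
    · refine mul_nonpos_of_nonneg_of_nonpos (h.precipitation_mem x ht).1 ?_
      have hs : 1 ≤ t + 1 := by linarith
      have hs0 : 0 < Real.sqrt (t + 1) := Real.sqrt_pos.2 (by linarith)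
      have h1 := erf_le (show 0 ≤ x / (2 * Real.sqrt (t + 1)) by positivity)
      have h2 : heatE x (t + 1) = 1 - erf (x / (2 * Real.sqrt (t + 1))) := erfc_eq_one_sub _
      have h3 : P / Real.sqrt Real.pi * X * (Real.sqrt (t + 1))⁻¹ ≤ K * heatG x (t + 1) := by
        rw [hKdef, heatG, mul_assoc _ (Real.exp _), mul_left_comm (Real.exp _), ← Real.exp_add]
        refine mul_le_mul_of_nonneg_left ?_ (by positivity)
        refine le_mul_of_one_le_right (by positivity) (Real.one_le_exp ?_)
        have h4 : x ^ 2 / (4 * (t + 1)) ≤ X ^ 2 / 4 := by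
          refine div_le_div₀ (by positivity) ?_ (by norm_num) (by linarith)
          nlinarith
        rw [neg_div]
        linarith
      have h4 : P * (2 / Real.sqrt Real.pi * (x / (2 * Real.sqrt (t + 1))))
          ≤ P / Real.sqrt Real.pi * X * (Real.sqrt (t + 1))⁻¹ := by
        have : P * (2 / Real.sqrt Real.pi * (x / (2 * Real.sqrt (t + 1))))
            = P / Real.sqrt Real.pi * x * (Real.sqrt (t + 1))⁻¹ := by field_simp
        rw [this]
        gcongr
      have h5 := mul_le_mul_of_nonneg_left h1 hP0
      have h6 := psi_le (x := x) hα hβ ht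
      rw [h2] at hlt
      nlinarith

end LongTime

/-- long-time behavior in the transitional regime `u*₀ < u* < Ψ(α)`:
precipitation is confined to a bounded region and `u` converges uniformly to `Φ₀`. -/
theorem transitional_longtime_behavior (α β ustar : ℝ) (hα : 0 < α) (hβ : 0 < β)
    (h₁ : ustarZero α β < ustar) (h₂ : ustar < PsiP α β α)
    (u p : ℝ → ℝ → ℝ) (hsol : IsWeakSolution α β ustar u p) :
    (∃ X > (0:ℝ), ∀ x t : ℝ, 0 ≤ t → X ≤ |x| → p x t = 0) ∧
    ConvUnif u (PhiZero α β) := by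
  have hex := hsol.exists_precipitation_eq_zero hα hβ h₁ h₂
  refine ⟨hex, fun ε hε => ?_⟩
  obtain ⟨X, hX, hp0⟩ := hex
  obtain ⟨C, hC, T, hT, hup⟩ := hsol.exists_upper_bound hα hβ h₂
  obtain ⟨K, hK, hlow⟩ := hsol.exists_lower_bound hα hβ hX hp0
  have hP0 : 0 ≤ PsiP α β α := PsiP_nonneg hα hβ _
  have hpi := two_div_sqrt_pi_pos
  set D := C + K + PsiP α β α * (2 / Real.sqrt Real.pi) + 1 with hD
  have hD0 : 0 < D := by positivity
  refine ⟨max T ((2 * D / ε) ^ 2), fun t ht η hη => ?_⟩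
  have ht0 : 0 < t := hT.trans_le ((le_max_left _ _).trans ht)
  have hs : 0 < Real.sqrt t := Real.sqrt_pos.2 ht0
  have hs1 : 0 < Real.sqrt (t + 1) := Real.sqrt_pos.2 (by linarith)
  have hDε : D / Real.sqrt t < ε := by
    have h1 : 2 * D / ε ≤ Real.sqrt t := Real.le_sqrt_of_sq_le ((le_max_right _ _).trans ht)
    rw [div_le_iff₀ hε] at h1
    rw [div_lt_iff₀ hs]
    linarith
  have hx : 0 ≤ η * Real.sqrt t := by positivity
  have hxη : η * Real.sqrt t / Real.sqrt t = η := by field_simp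
  have hu := hup _ t hx ((le_max_left _ _).trans ht)
  have hl := hlow _ t hx ht0.le
  rw [hxη] at hu
  rw [psi_of_pos ht0, abs_of_nonneg hx, hxη] at hl
  have hmono : Real.sqrt t ≤ Real.sqrt (t + 1) := Real.sqrt_le_sqrt (by linarith)
  have hρ := erfc_mul_sub_le (y := η / 2) (ρ := Real.sqrt t / Real.sqrt (t + 1)) (by positivity)
    (by positivity) ((div_le_one hs1).2 hmono)
  have hE : heatE (η * Real.sqrt t) (t + 1)
      = erfc (Real.sqrt t / Real.sqrt (t + 1) * (η / 2)) := by
    rw [heatE]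
    congr 1
    field_simp
  have hρ1 : (1 - Real.sqrt t / Real.sqrt (t + 1)) / (Real.sqrt t / Real.sqrt (t + 1))
      ≤ 1 / Real.sqrt t := by
    have h1 : (1 - Real.sqrt t / Real.sqrt (t + 1)) / (Real.sqrt t / Real.sqrt (t + 1))
        = (Real.sqrt (t + 1) - Real.sqrt t) / Real.sqrt t := by field_simp
    rw [h1]
    gcongr
    have := Real.sqrt_le_sqrt (show t + 1 ≤ (Real.sqrt t + 1) ^ 2 by
      nlinarith [Real.sq_sqrt ht0.le])
    rw [Real.sqrt_sq (by positivity)] at this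
    linarith
  have h3 := mul_le_mul_of_nonneg_left (hρ.trans (mul_le_mul_of_nonneg_left hρ1 hpi.le)) hP0
  have h4 : K / Real.sqrt (t + 1) ≤ K / Real.sqrt t := div_le_div_of_nonneg_left hK hs hmono
  have h5 : D / Real.sqrt t = C / Real.sqrt t + K / Real.sqrt t
      + PsiP α β α * (2 / Real.sqrt Real.pi * (1 / Real.sqrt t)) + 1 / Real.sqrt t := by
    rw [hD]; ring
  have h6 : 0 < 1 / Real.sqrt t := by positivity
  have h7 : 0 ≤ C / Real.sqrt t := by positivity
  have h8 : 0 ≤ K / Real.sqrt t := by positivity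
  have h9 : 0 ≤ PsiP α β α * (2 / Real.sqrt Real.pi * (1 / Real.sqrt t)) := by positivity
  rw [hE] at hl
  rw [abs_lt]
  constructor
  · rw [PhiZero_eq hα]
    linarith
  · linarith

end
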